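/- arXiv:2507.00772 — 17 statements merged into one kernel-verified Lean document; each statement's English description precedes it below -/
import Mathlib

section
/- Let 𝔮 ∈ ℂ and define the Moyal star product on ℂ[x,y] by f ⋆ g = Σ_{k≥0} (𝔮^k/k!) Σ_{j=0}^{k} (−1)^j C(k,j) (∂_x^{k−j}∂_y^j f)(∂_y^{k−j}∂_x^j g) (a finite sum on polynomials). Then for all natural numbers a,b,c,d: x^a y^b ⋆ x^c y^d − x^c y^d ⋆ x^a y^b = Σ_{l ≥ 0, 2l+1 ≤ min(a+c, b+d)} (2·𝔮^{2l+1}/(2l+1)!) · N_{2l}(a,b,c,d) · x^{a+c−2l−1} y^{b+d−2l−1}, where N_{2l}(a,b,c,d) = Σ_{j=0}^{2l+1} (−1)^j C(2l+1,j) [a]_{2l+1−j}[b]_j[d]_{2l+1−j}[c]_j. In the labels a = p+m−1, b = p−m−1, c = q+n−1, d = q−n−1 the coefficients N_{2l} are exactly the structure constants N^{pq}_{2l}(m,n) of the symplecton algebra W(−3/16); thus the Moyal bracket on the generators W^p_m = x^{p+m−1}y^{p−m−1} realizes this one-parameter Lie-algebra deformation of the wedge subalgebra of w_{1+∞}. 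-/
open MvPolynomial Finset

/-- `∂/∂x` on `ℂ[x,y]`. -/
noncomputable def dX : MvPolynomial (Fin 2) ℂ → MvPolynomial (Fin 2) ℂ := fun f => pderiv 0 f

/-- `∂/∂y` on `ℂ[x,y]`. -/
noncomputable def dY : MvPolynomial (Fin 2) ℂ → MvPolynomial (Fin 2) ℂ := fun f => pderiv 1 f

/-- The Moyal star product on polynomials,
`f ⋆ g = Σ_{k≥0} (𝔮^k/k!) Σ_{j=0}^{k} (−1)^j C(k,j) (∂_x^{k−j}∂_y^j f)(∂_y^{k−j}∂_x^j g)`;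
the sum over `k` is finite on polynomials since all terms with `k > totalDegree f` vanish. -/
noncomputable def moyalStar (q : ℂ) (f g : MvPolynomial (Fin 2) ℂ) : MvPolynomial (Fin 2) ℂ :=
  ∑ k ∈ Finset.range (f.totalDegree + 1),
    MvPolynomial.C (q ^ k / (k.factorial : ℂ)) *
      ∑ j ∈ Finset.range (k + 1),
        MvPolynomial.C ((-1 : ℂ) ^ j * (k.choose j : ℂ)) *
          (dX^[k - j] (dY^[j] f) * dY^[k - j] (dX^[j] g))

/-- The symplecton structure constants
`N_{2l}(a,b,c,d) = Σ_{j=0}^{2l+1} (−1)^j C(2l+1,j) [a]_{2l+1−j}[b]_j[d]_{2l+1−j}[c]_j`. -/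
noncomputable def moyalN (l a b c d : ℕ) : ℂ :=
  ∑ j ∈ Finset.range (2 * l + 2),
    (-1 : ℂ) ^ j * ((2 * l + 1).choose j : ℂ) *
      (a.descFactorial (2 * l + 1 - j) : ℂ) * (b.descFactorial j : ℂ) *
      (d.descFactorial (2 * l + 1 - j) : ℂ) * (c.descFactorial j : ℂ)

noncomputable def moyalS (k a b c d : ℕ) : ℂ :=
  ∑ j ∈ Finset.range (k + 1),
    (-1 : ℂ) ^ j * (k.choose j : ℂ) *
      (a.descFactorial (k - j) : ℂ) * (b.descFactorial j : ℂ) *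
      (d.descFactorial (k - j) : ℂ) * (c.descFactorial j : ℂ)

lemma dX_C_mul (r : ℂ) (a b : ℕ) :
    dX (C r * (X 0 ^ a * X 1 ^ b)) = C (r * a) * (X 0 ^ (a - 1) * X 1 ^ b) := by
  simp [dX, pderiv_mul, pderiv_pow, pderiv_X_self, pderiv_X_of_ne]
  ring

lemma dY_C_mul (r : ℂ) (a b : ℕ) :
    dY (C r * (X 0 ^ a * X 1 ^ b)) = C (r * b) * (X 0 ^ a * X 1 ^ (b - 1)) := by
  simp [dY, pderiv_mul, pderiv_pow, pderiv_X_self, pderiv_X_of_ne]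
  ring

lemma dX_iter (n : ℕ) (r : ℂ) (a b : ℕ) :
    dX^[n] (C r * (X 0 ^ a * X 1 ^ b)) =
      C (r * (a.descFactorial n : ℂ)) * (X 0 ^ (a - n) * X 1 ^ b) := by
  induction n with
  | zero => simp
  | succ n ih =>
    rw [Function.iterate_succ_apply', ih, dX_C_mul, Nat.descFactorial_succ, Nat.sub_sub]
    push_cast
    congr 2
    ring

lemma dY_iter (n : ℕ) (r : ℂ) (a b : ℕ) :
    dY^[n] (C r * (X 0 ^ a * X 1 ^ b)) =
      C (r * (b.descFactorial n : ℂ)) * (X 0 ^ a * X 1 ^ (b - n)) := by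
  induction n with
  | zero => simp
  | succ n ih =>
    rw [Function.iterate_succ_apply', ih, dY_C_mul, Nat.descFactorial_succ, Nat.sub_sub]
    push_cast
    congr 2
    ring

lemma inner_term (k j a b c d : ℕ) (hj : j ≤ k) :
    (C ((-1 : ℂ) ^ j * (k.choose j : ℂ)) *
          (dX^[k - j] (dY^[j] (X 0 ^ a * X 1 ^ b)) * dY^[k - j] (dX^[j] (X 0 ^ c * X 1 ^ d))) :
        MvPolynomial (Fin 2) ℂ) =
      C ((-1 : ℂ) ^ j * (k.choose j : ℂ) *
      (a.descFactorial (k - j) : ℂ) * (b.descFactorial j : ℂ) *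
      (d.descFactorial (k - j) : ℂ) * (c.descFactorial j : ℂ)) *
        (X 0 ^ (a + c - k) * X 1 ^ (b + d - k)) := by
  have h1 : ∀ a b : ℕ, (X 0 ^ a * X 1 ^ b : MvPolynomial (Fin 2) ℂ) =
      C 1 * (X 0 ^ a * X 1 ^ b) := by simp
  rw [h1 a b, h1 c d, dY_iter, dX_iter, dX_iter, dY_iter]
  by_cases ha : a < k - j
  · simp [Nat.descFactorial_of_lt ha]
  by_cases hb : b < j
  · simp [Nat.descFactorial_of_lt hb]
  by_cases hd : d < k - j
  · simp [Nat.descFactorial_of_lt hd]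
  by_cases hc : c < j
  · simp [Nat.descFactorial_of_lt hc]
  have e1 : a + c - k = (a - (k - j)) + (c - j) := by omega
  have e2 : b + d - k = (b - j) + (d - (k - j)) := by omega
  rw [e1, e2, pow_add, pow_add]
  simp only [map_mul, map_one]
  ring

lemma moyalS_zero (k a b c d : ℕ)
    (h : ∀ j ≤ k, a < k - j ∨ b < j ∨ d < k - j ∨ c < j) : moyalS k a b c d = 0 := by
  refine Finset.sum_eq_zero fun j hj => ?_
  have hj' : j ≤ k := by simp at hj; omega
  rcases h j hj' with h | h | h | h <;> simp [Nat.descFactorial_of_lt h]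

lemma moyalS_symm (k a b c d : ℕ) :
    moyalS k c d a b = (-1) ^ k * moyalS k a b c d := by
  unfold moyalS
  rw [← Finset.sum_range_reflect, Finset.mul_sum]
  refine Finset.sum_congr rfl fun j hj => ?_
  have hj' : j ≤ k := by simp at hj; omega
  have e : k + 1 - 1 - j = k - j := by omega
  have e2 : k - (k - j) = j := by omega
  rw [e, e2, Nat.choose_symm hj']
  have e3 : (-1 : ℂ) ^ (k - j) = (-1) ^ k * (-1) ^ j := by
    obtain ⟨m, rfl⟩ := Nat.exists_eq_add_of_le hj'
    rw [Nat.add_sub_cancel_left, pow_add]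
    have : (-1 : ℂ) ^ j * (-1) ^ j = 1 := by rw [← mul_pow]; simp
    linear_combination (-(-1 : ℂ) ^ m) * this
  rw [e3]
  ring

lemma star_eq (q : ℂ) (a b c d K : ℕ) (hK : a + b ≤ K) :
    moyalStar q (X 0 ^ a * X 1 ^ b) (X 0 ^ c * X 1 ^ d) =
      ∑ k ∈ Finset.range (K + 1), C (q ^ k / (k.factorial : ℂ) * moyalS k a b c d) *
        (X 0 ^ (a + c - k) * X 1 ^ (b + d - k)) := by
  have hdeg : (X 0 ^ a * X 1 ^ b : MvPolynomial (Fin 2) ℂ).totalDegree = a + b := by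
    rw [totalDegree_mul_of_isDomain (pow_ne_zero _ (X_ne_zero _)) (pow_ne_zero _ (X_ne_zero _)),
      totalDegree_X_pow, totalDegree_X_pow]
  unfold moyalStar
  rw [hdeg]
  have : ∀ k ∈ Finset.range (K + 1), k ∉ Finset.range (a + b + 1) →
      (C (q ^ k / (k.factorial : ℂ) * moyalS k a b c d) *
        (X 0 ^ (a + c - k) * X 1 ^ (b + d - k)) : MvPolynomial (Fin 2) ℂ) = 0 := by
    intro k _ hk
    rw [moyalS_zero]
    · simp
    · simp at hk
      intro j hj
      omega
  rw [← Finset.sum_subset (Finset.range_mono (by omega)) this]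
  refine Finset.sum_congr rfl fun k _ => ?_
  rw [map_mul, mul_assoc]
  congr 1
  unfold moyalS
  rw [map_sum, Finset.sum_mul]
  refine Finset.sum_congr rfl fun j hj => ?_
  exact inner_term k j a b c d (by simp at hj; omega)

/-- The Moyal commutator of two monomials realizes the one-parameter deformation `W(−3/16)`
of the wedge subalgebra of `w_{1+∞}`. -/
theorem moyal_commutator_monomials (q : ℂ) (a b c d : ℕ) :
    moyalStar q (X 0 ^ a * X 1 ^ b) (X 0 ^ c * X 1 ^ d) -
        moyalStar q (X 0 ^ c * X 1 ^ d) (X 0 ^ a * X 1 ^ b) =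
      ∑ l ∈ (Finset.range (min (a + c) (b + d) + 1)).filter
          (fun l => 2 * l + 1 ≤ min (a + c) (b + d)),
        MvPolynomial.C (2 * q ^ (2 * l + 1) / ((2 * l + 1).factorial : ℂ) * moyalN l a b c d) *
          (X 0 ^ (a + c - (2 * l + 1)) * X 1 ^ (b + d - (2 * l + 1))) := by
  rw [star_eq q a b c d (a + b + c + d) (by omega), star_eq q c d a b (a + b + c + d) (by omega),
    ← Finset.sum_sub_distrib]
  symm
  refine Finset.sum_of_injOn (fun l => 2 * l + 1) ?_ ?_ ?_ ?_
  · intro x _ y _ h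
    simp only at h
    omega
  · intro l hl
    simp only [Finset.coe_filter, Set.mem_setOf_eq, Finset.mem_range, Finset.coe_range,
      Set.mem_Iio] at hl ⊢
    omega
  · intro k _ hk
    rw [moyalS_symm k a b c d, add_comm c a, add_comm d b]
    rcases Nat.even_or_odd k with he | ho
    · rw [he.neg_one_pow]
      simp
    · rw [moyalS_zero]
      · simp
      · obtain ⟨l, rfl⟩ := ho
        have hk' : ¬ (2 * l + 1 ≤ min (a + c) (b + d)) := by
          intro h
          apply hk
          refine ⟨l, ?_, rfl⟩
          simp only [Finset.coe_filter, Set.mem_setOf_eq, Finset.mem_range]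
          omega
        intro j hj
        omega
  · intro l _
    have hS : moyalN l a b c d = moyalS (2 * l + 1) a b c d := rfl
    rw [moyalS_symm (2 * l + 1) a b c d, add_comm c a, add_comm d b, ← sub_mul, ← map_sub, hS]
    congr 2
    rw [Odd.neg_one_pow ⟨l, rfl⟩]
    ring
end

section
/- For all natural numbers l, m, n, r: [m+n]_l · Σ_{t=0}^{r} [t]_l · C(n,t) · C(m,r−t) = [r]_l · [n]_l · C(m+n,r). Equivalently, when l ≤ r, Σ_{t=0}^{r} [t]_l · C(n,t) · C(m,r−t) = [n]_l · C(m+n−l, r−l). (This is the generalized Vandermonde identity, eq. (2.37) of the paper, used to resum the Moyal-deformed celestial OPE into the W-algebra structure constants; in the closed form the Pochhammer factor is [n]_l.) -/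
theorem gv_key (l n k : ℕ) (h : l ≤ k) :
    k.descFactorial l * n.choose k = n.descFactorial l * (n - l).choose (k - l) := by
  rw [Nat.descFactorial_eq_factorial_mul_choose, Nat.descFactorial_eq_factorial_mul_choose,
    mul_assoc, mul_assoc, ← Nat.choose_mul h, mul_comm (k.choose l)]

theorem gv_closed (l m n r : ℕ) (h : l ≤ r) :
    ∑ t ∈ Finset.range (r + 1), t.descFactorial l * n.choose t * m.choose (r - t) =
      n.descFactorial l * (m + n - l).choose (r - l) := by
  obtain ⟨s, rfl⟩ := Nat.exists_eq_add_of_le h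
  rw [add_assoc, Finset.sum_range_add, Finset.sum_eq_zero, zero_add]
  · have h1 : ∀ i ∈ Finset.range (s + 1),
        (l + i).descFactorial l * n.choose (l + i) * m.choose (l + s - (l + i)) =
          n.descFactorial l * ((n - l).choose i * m.choose (s - i)) := by
      intro i _
      rw [gv_key l n (l + i) (Nat.le_add_right _ _), Nat.add_sub_cancel_left,
        Nat.add_sub_add_left, mul_assoc]
    rw [Finset.sum_congr rfl h1, ← Finset.mul_sum]
    rcases Nat.lt_or_ge n l with hn | hn
    · rw [Nat.descFactorial_eq_zero_iff_lt.2 hn, zero_mul, zero_mul]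
    · rw [Nat.add_sub_cancel_left, show m + n - l = (n - l) + m by omega, Nat.add_choose_eq,
        Finset.Nat.sum_antidiagonal_eq_sum_range_succ_mk]
  · intro t ht
    rw [Nat.descFactorial_eq_zero_iff_lt.2 (Finset.mem_range.1 ht), zero_mul, zero_mul]

/-- The generalized Vandermonde identity (eq. (2.37) of the paper):
`[m+n]_l · Σ_{t=0}^{r} [t]_l C(n,t) C(m,r−t) = [r]_l [n]_l C(m+n,r)`,
and equivalently, when `l ≤ r`,
`Σ_{t=0}^{r} [t]_l C(n,t) C(m,r−t) = [n]_l C(m+n−l, r−l)`. -/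
theorem generalized_vandermonde (l m n r : ℕ) :
    (m + n).descFactorial l *
        ∑ t ∈ Finset.range (r + 1), t.descFactorial l * n.choose t * m.choose (r - t) =
      r.descFactorial l * n.descFactorial l * (m + n).choose r ∧
    (l ≤ r →
      ∑ t ∈ Finset.range (r + 1), t.descFactorial l * n.choose t * m.choose (r - t) =
        n.descFactorial l * (m + n - l).choose (r - l)) := by
  refine ⟨?_, gv_closed l m n r⟩
  rcases Nat.lt_or_ge r l with h | h
  · rw [Finset.sum_eq_zero, Nat.descFactorial_eq_zero_iff_lt.2 h]
    · simp
    · intro t ht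
      have ht' := Finset.mem_range.1 ht
      rw [Nat.descFactorial_eq_zero_iff_lt.2 (by omega), zero_mul, zero_mul]
  · rw [gv_closed l m n r h, mul_right_comm, gv_key l (m + n) r h]
    ring
end

section
/- Let λ₁, λ₂, λ₃, α ∈ ℂ² and λ̃₁, λ̃₂, λ̃₃ ∈ ℂ², and write ⟨u v⟩ = u₁v₂ − u₂v₁ for the antisymmetric pairing on ℂ² (applied both to untilded and tilded spinors; abbreviate ⟨α i⟩ = ⟨α λᵢ⟩ and [i j] = ⟨λ̃ᵢ λ̃ⱼ⟩). Assume momentum conservation Σ_{i=1}^{3} λᵢ_a · λ̃ᵢ_ḃ = 0 for all a, ḃ ∈ {1,2}, and that ⟨α2⟩, ⟨α3⟩, [12], [23], [31] and 𝔮 ∈ ℂ are all nonzero. Then (⟨α1⟩/(⟨α2⟩⟨α3⟩))⁴ · ([23]⟨α2⟩⟨α3⟩/𝔮) · sinh(𝔮[23]⟨α2⟩⟨α3⟩) = ([23]⁷/([12][23][31])²) · sinh(𝔮[23]⟨α2⟩⟨α3⟩)/(𝔮⟨α2⟩⟨α3⟩). (The two expressions for the three-point MHV-bar amplitude of Moyal-deformed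 self-dual gravity agree on the support of momentum conservation.) -/
/-- The antisymmetric spinor pairing `⟨u v⟩ = u₁v₂ − u₂v₁` on `ℂ²`. -/
def spinorPair (u v : Fin 2 → ℂ) : ℂ := u 0 * v 1 - u 1 * v 0

/-- On the support of momentum conservation, the two expressions for the three-point
`MHV-bar` amplitude of Moyal-deformed self-dual gravity agree. -/
theorem moyal_three_point_amplitude
    (l1 l2 l3 α lt1 lt2 lt3 : Fin 2 → ℂ) (q : ℂ)
    (hmom : ∀ a b : Fin 2, l1 a * lt1 b + l2 a * lt2 b + l3 a * lt3 b = 0)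
    (h2 : spinorPair α l2 ≠ 0) (h3 : spinorPair α l3 ≠ 0)
    (h12 : spinorPair lt1 lt2 ≠ 0) (h23 : spinorPair lt2 lt3 ≠ 0)
    (h31 : spinorPair lt3 lt1 ≠ 0) (hq : q ≠ 0) :
    (spinorPair α l1 / (spinorPair α l2 * spinorPair α l3)) ^ 4 *
        (spinorPair lt2 lt3 * spinorPair α l2 * spinorPair α l3 / q) *
        Complex.sinh (q * spinorPair lt2 lt3 * spinorPair α l2 * spinorPair α l3) =
      spinorPair lt2 lt3 ^ 7 /
          (spinorPair lt1 lt2 * spinorPair lt2 lt3 * spinorPair lt3 lt1) ^ 2 *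
        (Complex.sinh (q * spinorPair lt2 lt3 * spinorPair α l2 * spinorPair α l3) /
          (q * spinorPair α l2 * spinorPair α l3)) := by
  have e3 : spinorPair α l1 * spinorPair lt1 lt2 = spinorPair α l3 * spinorPair lt2 lt3 := by
    simp only [spinorPair]
    linear_combination α 0 * lt2 1 * hmom 1 0 - α 1 * lt2 1 * hmom 0 0
      - α 0 * lt2 0 * hmom 1 1 + α 1 * lt2 0 * hmom 0 1
  have e2 : spinorPair α l1 * spinorPair lt3 lt1 = spinorPair α l2 * spinorPair lt2 lt3 := by
    simp only [spinorPair]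
    linear_combination -(α 0 * lt3 1 * hmom 1 0 - α 1 * lt3 1 * hmom 0 0
      - α 0 * lt3 0 * hmom 1 1 + α 1 * lt3 0 * hmom 0 1)
  generalize Complex.sinh _ = S
  generalize spinorPair α l1 = a1 at *
  generalize spinorPair α l2 = a2 at *
  generalize spinorPair α l3 = a3 at *
  generalize spinorPair lt1 lt2 = x at *
  generalize spinorPair lt2 lt3 = y at *
  generalize spinorPair lt3 lt1 = z at *
  have e : a1 ^ 4 * x ^ 2 * z ^ 2 = a2 ^ 2 * a3 ^ 2 * y ^ 4 := by
    calc _ = (a1 * x) ^ 2 * (a1 * z) ^ 2 := by ring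
      _ = _ := by rw [e2, e3]; ring
  have e' : a1 ^ 4 = a2 ^ 2 * a3 ^ 2 * y ^ 4 / (x ^ 2 * z ^ 2) := by
    rw [eq_div_iff (by positivity), ← e]; ring
  rw [div_pow, e']
  field_simp
end

section
/- On ℂ[X,Y,Z] with the bracket {f,g} = 2X(∂_X f ∂_Z g − ∂_Z f ∂_X g) − 2Y(∂_Y f ∂_Z g − ∂_Z f ∂_Y g) + 4Z(∂_X f ∂_Y g − ∂_Y f ∂_X g), for all natural numbers p,q,r,s with p+r ≥ 1 and q+s ≥ 1 one has the exact identity {X^p Y^q, X^r Y^s} = 4(ps − qr) · X^{p+r−1} Y^{q+s−1} Z. (This is the even–even relation of the celestial chiral algebra of self-dual gravity on Eguchi–Hanson space in the twistor basis V[2p,2q] = X^pY^q.) -/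
open MvPolynomial

/-- The weight `−2` Poisson structure on the fibres of the Eguchi–Hanson twistor space:
`{f,g} = 2X(∂_X f ∂_Z g − ∂_Z f ∂_X g) − 2Y(∂_Y f ∂_Z g − ∂_Z f ∂_Y g)
  + 4Z(∂_X f ∂_Y g − ∂_Y f ∂_X g)` on `ℂ[X,Y,Z]`. -/
noncomputable def ehBracket (f g : MvPolynomial (Fin 3) ℂ) : MvPolynomial (Fin 3) ℂ :=
  2 * X 0 * (pderiv 0 f * pderiv 2 g - pderiv 2 f * pderiv 0 g)
    - 2 * X 1 * (pderiv 1 f * pderiv 2 g - pderiv 2 f * pderiv 1 g)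
    + 4 * X 2 * (pderiv 0 f * pderiv 1 g - pderiv 1 f * pderiv 0 g)

/-- The even–even relation of the Eguchi–Hanson celestial chiral algebra in the twistor
basis: `{X^p Y^q, X^r Y^s} = 4(ps − qr) X^{p+r−1} Y^{q+s−1} Z`. -/
theorem eh_even_even (p q r s : ℕ) (hpr : 1 ≤ p + r) (hqs : 1 ≤ q + s) :
    ehBracket (X 0 ^ p * X 1 ^ q) (X 0 ^ r * X 1 ^ s) =
      MvPolynomial.C (4 * ((p : ℂ) * (s : ℂ) - (q : ℂ) * (r : ℂ))) *
        (X 0 ^ (p + r - 1) * X 1 ^ (q + s - 1) * X 2) := by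
  have h4 : (MvPolynomial.C (4 : ℂ) : MvPolynomial (Fin 3) ℂ) = 4 := map_ofNat _ 4
  unfold ehBracket
  rcases p with _ | p <;> rcases q with _ | q <;> rcases r with _ | r <;> rcases s with _ | s <;>
    first
    | omega
    | (simp only [Derivation.leibniz, Derivation.leibniz_pow, pderiv_X, Pi.single_apply, h4,
        map_mul, map_sub, map_natCast, smul_eq_mul, nsmul_eq_mul, Nat.add_sub_cancel,
        ← Nat.add_assoc, Nat.succ_add, zero_add, add_zero, Nat.zero_add, Nat.add_right_comm _ 1]
       simp
       try ring)
end

section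
/- On ℂ[X,Y,Z] with the bracket {f,g} = 2X(∂_X f ∂_Z g − ∂_Z f ∂_X g) − 2Y(∂_Y f ∂_Z g − ∂_Z f ∂_Y g) + 4Z(∂_X f ∂_Y g − ∂_Y f ∂_X g), let e ∈ ℂ and let 𝓘 be the ideal generated by XY − Z² + e. For all natural numbers p,q,r,s with p+r ≥ 1 and q+s ≥ 1: {X^p Y^q, X^r Y^s Z} − 2(p(2s+1) − q(2r+1))·X^{p+r} Y^{q+s} − 4e(ps − qr)·X^{p+r−1} Y^{q+s−1} ∈ 𝓘. (This is the even–odd relation of the Eguchi–Hanson celestial chiral algebra in the twistor basis, with e = c²(λ).) -/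
open MvPolynomial

/-- The even–odd relation of the Eguchi–Hanson celestial chiral algebra in the twistor
basis, modulo the Poisson ideal `𝓘 = (XY − Z² + e)`:
`{X^p Y^q, X^r Y^s Z} ≡ 2(p(2s+1) − q(2r+1)) X^{p+r} Y^{q+s}
  + 4e(ps − qr) X^{p+r−1} Y^{q+s−1}  (mod 𝓘)`. -/
theorem eh_even_odd (e : ℂ) (p q r s : ℕ) (hpr : 1 ≤ p + r) (hqs : 1 ≤ q + s) :
    ehBracket (X 0 ^ p * X 1 ^ q) (X 0 ^ r * X 1 ^ s * X 2)
        - MvPolynomial.C (2 * ((p : ℂ) * (2 * (s : ℂ) + 1) - (q : ℂ) * (2 * (r : ℂ) + 1))) *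
            (X 0 ^ (p + r) * X 1 ^ (q + s))
        - MvPolynomial.C (4 * e * ((p : ℂ) * (s : ℂ) - (q : ℂ) * (r : ℂ))) *
            (X 0 ^ (p + r - 1) * X 1 ^ (q + s - 1))
      ∈ Ideal.span {X 0 * X 1 - X 2 ^ 2 + MvPolynomial.C e} := by
  rw [Ideal.mem_span_singleton]
  refine ⟨-(C (4 * ((p : ℂ) * (s : ℂ) - (q : ℂ) * (r : ℂ)))) *
    (X 0 ^ (p + r - 1) * X 1 ^ (q + s - 1)), ?_⟩
  have h10 : (1 : Fin 3) ≠ 0 := by decide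
  have h20 : (2 : Fin 3) ≠ 0 := by decide
  have h21 : (2 : Fin 3) ≠ 1 := by decide
  have c2 : (C (2 : ℂ) : MvPolynomial (Fin 3) ℂ) = 2 := map_ofNat C 2
  have c4 : (C (4 : ℂ) : MvPolynomial (Fin 3) ℂ) = 4 := map_ofNat C 4
  unfold ehBracket
  simp only [Derivation.leibniz, Derivation.leibniz_pow, pderiv_X_self, smul_eq_mul,
    pderiv_X_of_ne h10, pderiv_X_of_ne h20, pderiv_X_of_ne h21, pderiv_X_of_ne h10.symm,
    pderiv_X_of_ne h20.symm, pderiv_X_of_ne h21.symm, nsmul_eq_mul,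
    map_mul, map_sub, map_add, map_one, map_natCast, c2, c4]
  rcases p with _ | p <;> rcases r with _ | r <;> first | omega | skip
  all_goals rcases q with _ | q <;> rcases s with _ | s <;> first | omega | skip
  all_goals
    simp only [Nat.add_sub_cancel, Nat.zero_add, Nat.add_zero, ← Nat.add_assoc,
      Nat.succ_add_sub_one, Nat.cast_zero, Nat.cast_add, Nat.cast_one,
      show ∀ a b : ℕ, a + 1 + b = a + b + 1 from fun a b => by omega]
    ring
end

section
/- On ℂ[X,Y,Z] with the bracket {f,g} = 2X(∂_X f ∂_Z g − ∂_Z f ∂_X g) − 2Y(∂_Y f ∂_Z g − ∂_Z f ∂_Y g) + 4Z(∂_X f ∂_Y g − ∂_Y f ∂_X g), let e ∈ ℂ and let 𝓘 be the ideal generated by XY − Z² + e. For all natural numbers p,q,r,s with p+r ≥ 1 and q+s ≥ 1: {X^p Y^q Z, X^r Y^s Z} − ((2p+1)(2s+1) − (2q+1)(2r+1))·X^{p+r} Y^{q+s} Z − 4e(ps − qr)·X^{p+r−1} Y^{q+s−1} Z ∈ 𝓘. (This is the odd–odd relation of the Eguchi–Hanson celestial chiral algebra in the twistor basis, with e = c²(λ).)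 -/
open MvPolynomial

/-- The odd–odd relation of the Eguchi–Hanson celestial chiral algebra in the twistor
basis, modulo the Poisson ideal `𝓘 = (XY − Z² + e)`:
`{X^p Y^q Z, X^r Y^s Z} ≡ ((2p+1)(2s+1) − (2q+1)(2r+1)) X^{p+r} Y^{q+s} Z
  + 4e(ps − qr) X^{p+r−1} Y^{q+s−1} Z  (mod 𝓘)`. -/
theorem eh_odd_odd (e : ℂ) (p q r s : ℕ) (hpr : 1 ≤ p + r) (hqs : 1 ≤ q + s) :
    ehBracket (X 0 ^ p * X 1 ^ q * X 2) (X 0 ^ r * X 1 ^ s * X 2)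
        - MvPolynomial.C ((2 * (p : ℂ) + 1) * (2 * (s : ℂ) + 1)
              - (2 * (q : ℂ) + 1) * (2 * (r : ℂ) + 1)) *
            (X 0 ^ (p + r) * X 1 ^ (q + s) * X 2)
        - MvPolynomial.C (4 * e * ((p : ℂ) * (s : ℂ) - (q : ℂ) * (r : ℂ))) *
            (X 0 ^ (p + r - 1) * X 1 ^ (q + s - 1) * X 2)
      ∈ Ideal.span {X 0 * X 1 - X 2 ^ 2 + MvPolynomial.C e} := by
  rw [Ideal.mem_span_singleton]
  refine ⟨-(4 * MvPolynomial.C ((p : ℂ) * (s : ℂ) - (q : ℂ) * (r : ℂ))) *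
    (X 0 ^ (p + r - 1) * X 1 ^ (q + s - 1) * X 2), ?_⟩
  have h4 : (MvPolynomial.C (4 : ℂ) : MvPolynomial (Fin 3) ℂ) = 4 := map_ofNat _ 4
  have h2 : (MvPolynomial.C (2 : ℂ) : MvPolynomial (Fin 3) ℂ) = 2 := map_ofNat _ 2
  have e1 : ∀ a b : ℕ, a + 1 + (b + 1) - 1 = a + b + 1 := by intros; omega
  have e2 : ∀ a b : ℕ, a + 1 + b - 1 = a + b := by intros; omega
  unfold ehBracket
  rcases p with _ | p <;> rcases r with _ | r <;> rcases q with _ | q <;>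
    rcases s with _ | s <;> first
    | omega
    | (simp [Derivation.leibniz, Derivation.leibniz_pow, pderiv_X, Pi.single_apply, e1, e2, h2, h4]
       try ring)
end

section
/- Let c ∈ ℂ and let (μ₁, μ₂) ∈ ℂ² with (μ₁, μ₂) ≠ (0,0); set ρ = |μ₁|² + |μ₂|² and define X = μ₁² − c²·(conj μ₂)²/ρ², Y = μ₂² − c²·(conj μ₁)²/ρ², Z = μ₁μ₂ + c²·(conj μ₁)(conj μ₂)/ρ². Then X·Y − Z² = −c². (Hence the holomorphic coordinates X^{α̇β̇} = μ^{α̇}μ^{β̇} − c²(λ) μ̂^{α̇}μ̂^{β̇}/[μ μ̂]² produced by the backreaction of the defect satisfy X^{α̇β̇}X_{α̇β̇} = −2c²(λ), so each fibre of the backreacted twistor space is the Eguchi–Hanson quadric XY = (Z − c(λ))(Z + c(λ)).) -/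
/-- The holomorphic coordinates produced by the defect backreaction satisfy the
Eguchi–Hanson quadric relation `X·Y − Z² = −c²` on each twistor fibre. -/
theorem eh_backreaction_quadric (c μ1 μ2 ρ : ℂ) (h : (μ1, μ2) ≠ ((0 : ℂ), (0 : ℂ)))
    (hρ : ρ = μ1 * (starRingEnd ℂ) μ1 + μ2 * (starRingEnd ℂ) μ2) :
    (μ1 ^ 2 - c ^ 2 * ((starRingEnd ℂ) μ2) ^ 2 / ρ ^ 2) *
        (μ2 ^ 2 - c ^ 2 * ((starRingEnd ℂ) μ1) ^ 2 / ρ ^ 2) -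
      (μ1 * μ2 + c ^ 2 * (starRingEnd ℂ) μ1 * (starRingEnd ℂ) μ2 / ρ ^ 2) ^ 2 = -c ^ 2 := by
  have hne : ρ ≠ 0 := by
    intro h0
    apply h
    rw [h0, Complex.mul_conj, Complex.mul_conj] at hρ
    have h1 : Complex.normSq μ1 + Complex.normSq μ2 = 0 := by exact_mod_cast hρ.symm
    have a1 := Complex.normSq_nonneg μ1
    have a2 := Complex.normSq_nonneg μ2
    have b1 : μ1 = 0 := Complex.normSq_eq_zero.mp (by linarith)
    have b2 : μ2 = 0 := Complex.normSq_eq_zero.mp (by linarith)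
    rw [b1, b2]
  generalize (starRingEnd ℂ) μ1 = m1 at *
  generalize (starRingEnd ℂ) μ2 = m2 at *
  have key : (μ1 ^ 2 - c ^ 2 * m2 ^ 2 / ρ ^ 2) * (μ2 ^ 2 - c ^ 2 * m1 ^ 2 / ρ ^ 2) -
      (μ1 * μ2 + c ^ 2 * m1 * m2 / ρ ^ 2) ^ 2 =
      -c ^ 2 * ((μ1 * m1 + μ2 * m2) ^ 2 / ρ ^ 2) := by ring
  rw [key, ← hρ, div_self (pow_ne_zero 2 hne), mul_one]
end

section
/- Let c ∈ ℂ. For (μ₁, μ₂) ∈ ℂ² \ {0} set ρ = |μ₁|² + |μ₂|², and define the three functions F₁ = μ₁² − c²·(conj μ₂)²/ρ², F₂ = μ₂² − c²·(conj μ₁)²/ρ², F₃ = μ₁μ₂ + c²·(conj μ₁)(conj μ₂)/ρ² on ℂ² \ {0}. Then each F ∈ {F₁, F₂, F₃} is annihilated by the deformed Dolbeault operator of the defect backreaction: for every point of ℂ² \ {0} and each j ∈ {1,2}, ∂̄_j F + (c²·ω_j/ρ³)·(−(conj μ₂)·∂₁F + (conj μ₁)·∂₂F) = 0, where (ω₁,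 ω₂) = (conj μ₂, −conj μ₁) and ∂_j, ∂̄_j are the Wirtinger derivatives. (This is the computation ∇̄ X^{α̇β̇} = 0 showing that X^{α̇β̇} = μ^{α̇}μ^{β̇} − c²(λ)μ̂^{α̇}μ̂^{β̇}/[μ μ̂]² are holomorphic coordinates on the Eguchi–Hanson twistor space, with ∇̄ = ∂̄ + {h, ·} for the backreacted Hamiltonian h.) -/
/-- The holomorphic Wirtinger derivative `∂_j f(z) = ½(Df(z)(e_j) − i·Df(z)(i·e_j))`. -/
noncomputable def wirtingerD (f : (Fin 2 → ℂ) → ℂ) (z : Fin 2 → ℂ) (j : Fin 2) : ℂ :=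
  (1 / 2) * (fderiv ℝ f z (Pi.single j 1) - Complex.I * fderiv ℝ f z (Pi.single j Complex.I))

/-- The antiholomorphic Wirtinger derivative `∂̄_j f(z) = ½(Df(z)(e_j) + i·Df(z)(i·e_j))`. -/
noncomputable def wirtingerDBar (f : (Fin 2 → ℂ) → ℂ) (z : Fin 2 → ℂ) (j : Fin 2) : ℂ :=
  (1 / 2) * (fderiv ℝ f z (Pi.single j 1) + Complex.I * fderiv ℝ f z (Pi.single j Complex.I))

/-- `ρ = |μ₁|² + |μ₂|²`, as a complex number. -/
noncomputable def rhoEH (z : Fin 2 → ℂ) : ℂ :=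
  z 0 * (starRingEnd ℂ) (z 0) + z 1 * (starRingEnd ℂ) (z 1)

/-- `F₁ = μ₁² − c²·(conj μ₂)²/ρ²`. -/
noncomputable def ehF1 (c : ℂ) (z : Fin 2 → ℂ) : ℂ :=
  (z 0) ^ 2 - c ^ 2 * ((starRingEnd ℂ) (z 1)) ^ 2 / (rhoEH z) ^ 2

/-- `F₂ = μ₂² − c²·(conj μ₁)²/ρ²`. -/
noncomputable def ehF2 (c : ℂ) (z : Fin 2 → ℂ) : ℂ :=
  (z 1) ^ 2 - c ^ 2 * ((starRingEnd ℂ) (z 0)) ^ 2 / (rhoEH z) ^ 2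

/-- `F₃ = μ₁μ₂ + c²·(conj μ₁)(conj μ₂)/ρ²`. -/
noncomputable def ehF3 (c : ℂ) (z : Fin 2 → ℂ) : ℂ :=
  z 0 * z 1 + c ^ 2 * (starRingEnd ℂ) (z 0) * (starRingEnd ℂ) (z 1) / (rhoEH z) ^ 2

theorem rhoEH_ne_zero (z : Fin 2 → ℂ) (hz : z ≠ 0) : rhoEH z ≠ 0 := by
  intro h
  apply hz
  unfold rhoEH at h
  rw [Complex.mul_conj, Complex.mul_conj] at h
  have h' : Complex.normSq (z 0) + Complex.normSq (z 1) = 0 := by exact_mod_cast h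
  have h0 := Complex.normSq_nonneg (z 0)
  have h1 := Complex.normSq_nonneg (z 1)
  have e0 : z 0 = 0 := Complex.normSq_eq_zero.mp (by linarith)
  have e1 : z 1 = 0 := Complex.normSq_eq_zero.mp (by linarith)
  funext k
  fin_cases k
  · exact e0
  · exact e1

theorem differentiableAt_coord (z : Fin 2 → ℂ) (k : Fin 2) :
    DifferentiableAt ℝ (fun w : Fin 2 → ℂ => w k) z := by fun_prop

theorem differentiableAt_conj (z : Fin 2 → ℂ) (k : Fin 2) :
    DifferentiableAt ℝ (fun w : Fin 2 → ℂ => (starRingEnd ℂ) (w k)) z :=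
  (Complex.conjCLE.toContinuousLinearMap.differentiableAt).comp z (differentiableAt_coord z k)

theorem differentiableAt_rhoEH (z : Fin 2 → ℂ) : DifferentiableAt ℝ rhoEH z :=
  ((differentiableAt_coord z 0).mul (differentiableAt_conj z 0)).add
    ((differentiableAt_coord z 1).mul (differentiableAt_conj z 1))

theorem fderiv_coord (z v : Fin 2 → ℂ) (k : Fin 2) :
    HasDerivAt (fun t : ℝ => (z + t • v) k) (v k) 0 := by
  have h : HasDerivAt (fun t : ℝ => z k + t • v k) ((1 : ℝ) • v k) 0 :=
    ((hasDerivAt_id (0 : ℝ)).smul_const (v k)).const_add (z k)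
  simpa using h

theorem fderiv_conj (z v : Fin 2 → ℂ) (k : Fin 2) :
    HasDerivAt (fun t : ℝ => (starRingEnd ℂ) ((z + t • v) k)) ((starRingEnd ℂ) (v k)) 0 :=
  (Complex.conjCLE.toContinuousLinearMap.hasFDerivAt).comp_hasDerivAt (0 : ℝ) (fderiv_coord z v k)

theorem line_rho (z v : Fin 2 → ℂ) :
    HasDerivAt (fun t : ℝ => rhoEH (z + t • v))
      (v 0 * (starRingEnd ℂ) (z 0) + z 0 * (starRingEnd ℂ) (v 0)
        + (v 1 * (starRingEnd ℂ) (z 1) + z 1 * (starRingEnd ℂ) (v 1))) 0 := by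
  have h := ((fderiv_coord z v 0).mul (fderiv_conj z v 0)).add
    ((fderiv_coord z v 1).mul (fderiv_conj z v 1))
  exact h.congr_deriv (by simp)

theorem fderiv_of_line (F : (Fin 2 → ℂ) → ℂ) (z v : Fin 2 → ℂ) (d : ℂ)
    (hF : DifferentiableAt ℝ F z) (h : HasDerivAt (fun t : ℝ => F (z + t • v)) d 0) :
    fderiv ℝ F z v = d := by
  rw [← hF.lineDeriv_eq_fderiv]
  exact h.deriv

/-- Derivative of `P + κ Q / ρ²`. -/
theorem fderiv_quot (P Q : (Fin 2 → ℂ) → ℂ) (z v : Fin 2 → ℂ) (p q : ℂ) (hz : z ≠ 0)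
    (hP : DifferentiableAt ℝ P z) (hQ : DifferentiableAt ℝ Q z)
    (hp : HasDerivAt (fun t : ℝ => P (z + t • v)) p 0)
    (hq : HasDerivAt (fun t : ℝ => Q (z + t • v)) q 0) :
    fderiv ℝ (fun w => P w + Q w / rhoEH w ^ 2) z v
      = p + (q / rhoEH z ^ 2 - 2 * Q z * (v 0 * (starRingEnd ℂ) (z 0) + z 0 * (starRingEnd ℂ) (v 0)
        + (v 1 * (starRingEnd ℂ) (z 1) + z 1 * (starRingEnd ℂ) (v 1))) / rhoEH z ^ 3) := by
  have hr := rhoEH_ne_zero z hz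
  apply fderiv_of_line
  · have h2 : DifferentiableAt ℝ (fun w => rhoEH w ^ 2) z := (differentiableAt_rhoEH z).pow 2
    have h3 : DifferentiableAt ℝ (fun w => (rhoEH w ^ 2)⁻¹) z := h2.inv (pow_ne_zero 2 hr)
    simp only [div_eq_mul_inv]
    exact hP.add (hQ.mul h3)
  · have h := hp.add (hq.div ((line_rho z v).pow 2) (by simpa using hr))
    refine h.congr_deriv ?_
    simp
    field_simp

theorem fderiv_ehF1 (c : ℂ) (z v : Fin 2 → ℂ) (hz : z ≠ 0) :
    fderiv ℝ (ehF1 c) z v = 2 * z 0 * v 0 +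
      (-c ^ 2 * (2 * (starRingEnd ℂ) (z 1) * (starRingEnd ℂ) (v 1)) / rhoEH z ^ 2
      - 2 * (-c ^ 2 * (starRingEnd ℂ) (z 1) ^ 2)
        * (v 0 * (starRingEnd ℂ) (z 0) + z 0 * (starRingEnd ℂ) (v 0)
        + (v 1 * (starRingEnd ℂ) (z 1) + z 1 * (starRingEnd ℂ) (v 1))) / rhoEH z ^ 3) := by
  have e : ehF1 c = fun w => w 0 ^ 2 + (-c ^ 2 * (starRingEnd ℂ) (w 1) ^ 2) / rhoEH w ^ 2 := by
    funext w; unfold ehF1; ring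
  rw [e]
  refine fderiv_quot (fun w => w 0 ^ 2) (fun w => -c ^ 2 * (starRingEnd ℂ) (w 1) ^ 2) z v _ _ hz
    ((differentiableAt_coord z 0).pow 2) (((differentiableAt_conj z 1).pow 2).const_mul _) ?_ ?_
  · exact HasDerivAt.congr_deriv ((fderiv_coord z v 0).pow 2) (by simp)
  · exact HasDerivAt.congr_deriv (((fderiv_conj z v 1).pow 2).const_mul (-c ^ 2)) (by simp)

theorem fderiv_ehF2 (c : ℂ) (z v : Fin 2 → ℂ) (hz : z ≠ 0) :
    fderiv ℝ (ehF2 c) z v = 2 * z 1 * v 1 +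
      (-c ^ 2 * (2 * (starRingEnd ℂ) (z 0) * (starRingEnd ℂ) (v 0)) / rhoEH z ^ 2
      - 2 * (-c ^ 2 * (starRingEnd ℂ) (z 0) ^ 2)
        * (v 0 * (starRingEnd ℂ) (z 0) + z 0 * (starRingEnd ℂ) (v 0)
        + (v 1 * (starRingEnd ℂ) (z 1) + z 1 * (starRingEnd ℂ) (v 1))) / rhoEH z ^ 3) := by
  have e : ehF2 c = fun w => w 1 ^ 2 + (-c ^ 2 * (starRingEnd ℂ) (w 0) ^ 2) / rhoEH w ^ 2 := by
    funext w; unfold ehF2; ring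
  rw [e]
  refine fderiv_quot (fun w => w 1 ^ 2) (fun w => -c ^ 2 * (starRingEnd ℂ) (w 0) ^ 2) z v _ _ hz
    ((differentiableAt_coord z 1).pow 2) (((differentiableAt_conj z 0).pow 2).const_mul _) ?_ ?_
  · exact HasDerivAt.congr_deriv ((fderiv_coord z v 1).pow 2) (by simp)
  · exact HasDerivAt.congr_deriv (((fderiv_conj z v 0).pow 2).const_mul (-c ^ 2)) (by simp)

theorem fderiv_ehF3 (c : ℂ) (z v : Fin 2 → ℂ) (hz : z ≠ 0) :
    fderiv ℝ (ehF3 c) z v = (v 0 * z 1 + z 0 * v 1) +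
      (c ^ 2 * ((starRingEnd ℂ) (v 0) * (starRingEnd ℂ) (z 1)
          + (starRingEnd ℂ) (z 0) * (starRingEnd ℂ) (v 1)) / rhoEH z ^ 2
      - 2 * (c ^ 2 * ((starRingEnd ℂ) (z 0) * (starRingEnd ℂ) (z 1)))
        * (v 0 * (starRingEnd ℂ) (z 0) + z 0 * (starRingEnd ℂ) (v 0)
        + (v 1 * (starRingEnd ℂ) (z 1) + z 1 * (starRingEnd ℂ) (v 1))) / rhoEH z ^ 3) := by
  have e : ehF3 c = fun w => w 0 * w 1 +
      (c ^ 2 * ((starRingEnd ℂ) (w 0) * (starRingEnd ℂ) (w 1))) / rhoEH w ^ 2 := by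
    funext w; unfold ehF3; ring
  rw [e]
  refine fderiv_quot (fun w => w 0 * w 1)
    (fun w => c ^ 2 * ((starRingEnd ℂ) (w 0) * (starRingEnd ℂ) (w 1))) z v _ _ hz
    ((differentiableAt_coord z 0).mul (differentiableAt_coord z 1))
    (((differentiableAt_conj z 0).mul (differentiableAt_conj z 1)).const_mul _) ?_ ?_
  · exact HasDerivAt.congr_deriv ((fderiv_coord z v 0).mul (fderiv_coord z v 1)) (by simp)
  · exact HasDerivAt.congr_deriv (((fderiv_conj z v 0).mul (fderiv_conj z v 1)).const_mul (c ^ 2)) (by simp)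

/-- Each of `F₁, F₂, F₃` is annihilated by the deformed Dolbeault operator of the defect
backreaction: `∂̄_j F + (c²·ω_j/ρ³)·(−(conj μ₂)·∂₁F + (conj μ₁)·∂₂F) = 0` on `ℂ² \ {0}`,
where `(ω₁, ω₂) = (conj μ₂, −conj μ₁)`. -/
theorem eh_coordinates_holomorphic (c : ℂ) (z : Fin 2 → ℂ) (hz : z ≠ 0) (j : Fin 2)
    (F : (Fin 2 → ℂ) → ℂ) (hF : F = ehF1 c ∨ F = ehF2 c ∨ F = ehF3 c) :
    wirtingerDBar F z j +
        (c ^ 2 * (if j = 0 then (starRingEnd ℂ) (z 1) else -(starRingEnd ℂ) (z 0)) /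
            (rhoEH z) ^ 3) *
          (-(starRingEnd ℂ) (z 1) * wirtingerD F z 0 +
            (starRingEnd ℂ) (z 0) * wirtingerD F z 1) = 0 := by
  have hr := rhoEH_ne_zero z hz
  have hI : Complex.I ^ 2 = -1 := Complex.I_sq
  have hρ : rhoEH z = z 0 * (starRingEnd ℂ) (z 0) + z 1 * (starRingEnd ℂ) (z 1) := rfl
  unfold wirtingerDBar wirtingerD
  generalize hR : rhoEH z = R at *
  rcases hF with rfl | rfl | rfl <;> fin_cases j <;>
    simp only [fderiv_ehF1 c z _ hz, fderiv_ehF2 c z _ hz, fderiv_ehF3 c z _ hz, hR] <;>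
    simp <;>
    generalize (starRingEnd ℂ) (z 0) = A at * <;>
    generalize (starRingEnd ℂ) (z 1) = B at * <;>
    generalize z 0 = a at * <;>
    generalize z 1 = b at * <;>
    field_simp <;>
    ring_nf <;> simp only [hI] <;> subst hρ <;> ring_nf
end

section
/- Let x be a 2×2 complex matrix with det x ≠ 0, let λ, α, β ∈ ℂ², and let c ∈ ℂ. Write ω(u,v) = u₁v₂ − u₂v₁ for the antisymmetric pairing on ℂ², define M± = x·λ ± (c·ω(α,λ)/det x)·x·β ∈ ℂ², and set X = (M₊)₁(M₋)₁, Y = (M₊)₂(M₋)₂, Z = ½((M₊)₁(M₋)₂ + (M₊)₂(M₋)₁). Then X·Y − Z² = −c²·ω(α,λ)²·ω(λ,β)². (Hence the incidence relations X^{α̇β̇} = x^{α̇α}x^{β̇β}(λ_αλ_β − (4c²⟨αλ⟩²/x⁴)β_αβ_β) of the paper, with x² = 2·det x, define holomorphic sections of the Eguchi–Hanson twistor quadric X^{α̇β̇}X_{α̇β̇} = −2c²(λ) with c(λ) = c⟨αλ⟩⟨λβ⟩.) -/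
open Matrix

/-- The incidence relations of the Eguchi–Hanson twistor space: with
`M± = x·λ ± (c·ω(α,λ)/det x)·x·β`, the coordinates `X = (M₊)₁(M₋)₁`, `Y = (M₊)₂(M₋)₂`,
`Z = ½((M₊)₁(M₋)₂ + (M₊)₂(M₋)₁)` satisfy `X·Y − Z² = −c²·ω(α,λ)²·ω(λ,β)²`. -/
theorem eh_incidence_quadric (x : Matrix (Fin 2) (Fin 2) ℂ) (hx : x.det ≠ 0)
    (lam α β : Fin 2 → ℂ) (c : ℂ) (Mp Mm : Fin 2 → ℂ)
    (hMp : Mp = x.mulVec lam + (c * spinorPair α lam / x.det) • x.mulVec β)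
    (hMm : Mm = x.mulVec lam - (c * spinorPair α lam / x.det) • x.mulVec β) :
    (Mp 0 * Mm 0) * (Mp 1 * Mm 1) - ((1 / 2) * (Mp 0 * Mm 1 + Mp 1 * Mm 0)) ^ 2 =
      -c ^ 2 * spinorPair α lam ^ 2 * spinorPair lam β ^ 2 := by
  have hk : c * spinorPair α lam / x.det * x.det = c * spinorPair α lam :=
    div_mul_cancel₀ _ hx
  generalize c * spinorPair α lam / x.det = k at hk hMp hMm
  have key : -c ^ 2 * spinorPair α lam ^ 2 * spinorPair lam β ^ 2 =
      -(k * x.det) ^ 2 * spinorPair lam β ^ 2 := by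
    rw [hk]; ring
  rw [key, hMp, hMm, Matrix.det_fin_two]
  simp only [spinorPair, Matrix.mulVec, dotProduct, Fin.sum_univ_two, Pi.add_apply,
    Pi.sub_apply, Pi.smul_apply, smul_eq_mul]
  ring
end

section
/- For all natural numbers p, q, ℓ: ℓ! · [2(p+q)]_{2ℓ} · (2p)! · (2q)! · Σ_{a=ℓ}^{min(p,q)} 4^{a−ℓ} · C(a,ℓ) · (p+q)!/((p−a)!·(q−a)!·(2a)!) = (2p+2q)! · [p]_ℓ · [q]_ℓ · [p+q]_ℓ (the sum being empty, hence zero, when ℓ > min(p,q), in which case the right-hand side also vanishes). Equivalently, the even soft-graviton generators on Eguchi–Hanson space expand in the twistor basis as W[2p,2q] = Σ_ℓ (2c(λ))^{2ℓ} C₀(p,q,ℓ) V[2p−2ℓ, 2q−2ℓ] with C₀(p,q,ℓ) = [p]_ℓ[q]_ℓ[p+q]_ℓ/(ℓ!·[2(p+q)]_{2ℓ}); this upper-triangular change of basis underlies the isomorphism between the scattering-basis and twistor-basis celestial chiral algebras. -/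
open Finset in
theorem eh_aux (Q : ℕ) : ∀ P l : ℕ,
    ∑ k ∈ range (Q + 1), (4 : ℚ) ^ k * (l + k).choose l * P.descFactorial k * Q.descFactorial k
        / (2 * l + 2 * k).factorial =
      (2 * P + 2 * Q + 2 * l).factorial * (P + l).factorial * (Q + l).factorial /
        ((P + Q + l).factorial * l.factorial * (2 * P + 2 * l).factorial
          * (2 * Q + 2 * l).factorial) := by
  induction Q with
  | zero =>
    intro P l
    have h1 : ((P + l).factorial : ℚ) ≠ 0 := by positivity
    have h2 : ((2 * P + 2 * l).factorial : ℚ) ≠ 0 := by positivity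
    have h3 : (l.factorial : ℚ) ≠ 0 := by positivity
    have h4 : ((2 * l).factorial : ℚ) ≠ 0 := by positivity
    simp
    field_simp
  | succ Q ih =>
    intro P l
    have key : ∑ k ∈ range (Q + 1 + 1), (4 : ℚ) ^ k * (l + k).choose l * P.descFactorial k
          * (Q + 1).descFactorial k / (2 * l + 2 * k).factorial =
        ∑ k ∈ range (Q + 1), (4 : ℚ) ^ k * (l + k).choose l * P.descFactorial k
          * Q.descFactorial k / (2 * l + 2 * k).factorial +
        4 * (l + 1) * P * ∑ k ∈ range (Q + 1), (4 : ℚ) ^ k * (l + 1 + k).choose (l + 1)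
          * (P - 1).descFactorial k * Q.descFactorial k / (2 * (l + 1) + 2 * k).factorial := by
      have e1 : ∑ k ∈ range (Q + 1), (4 : ℚ) ^ k * (l + k).choose l * P.descFactorial k
          * Q.descFactorial k / (2 * l + 2 * k).factorial =
          ∑ k ∈ range (Q + 1 + 1), (4 : ℚ) ^ k * (l + k).choose l * P.descFactorial k
          * Q.descFactorial k / (2 * l + 2 * k).factorial := by
        rw [sum_range_succ _ (Q + 1)]
        simp [Nat.descFactorial_of_lt]
      rw [e1, sum_range_succ' _ (Q + 1), sum_range_succ' _ (Q + 1), mul_sum]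
      simp only [Nat.descFactorial_zero]
      rw [add_right_comm, ← sum_add_distrib]
      congr 1
      apply sum_congr rfl
      intro j hj
      have hjQ : j ≤ Q := by simp at hj; omega
      have d1 : ((Q + 1).descFactorial (j + 1) : ℚ) =
          Q.descFactorial (j + 1) + (j + 1) * Q.descFactorial j := by
        rw [Nat.succ_descFactorial_succ, Nat.descFactorial_succ]
        push_cast [Nat.cast_sub hjQ]
        ring
      have d2 : (P.descFactorial (j + 1) : ℚ) = P * (P - 1).descFactorial j := by
        cases P with
        | zero => simp
        | succ P => rw [Nat.succ_descFactorial_succ]; push_cast; simp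
      have d3 : ((j : ℚ) + 1) * (l + (j + 1)).choose l
          = (l + 1) * (l + 1 + j).choose (l + 1) := by
        have := Nat.choose_succ_right_eq (l + 1 + j) l
        rw [show l + 1 + j - l = j + 1 by omega] at this
        rw [show l + (j + 1) = l + 1 + j by omega]
        have h : (((l + 1 + j).choose (l + 1) * (l + 1) : ℕ) : ℚ)
          = ((l + 1 + j).choose l * (j + 1) : ℕ) := by rw [this]
        push_cast at h
        linarith
      rw [d1, show 2 * (l + 1) + 2 * j = 2 * l + 2 * (j + 1) by ring, mul_add, add_div]
      congr 1
      rw [d2, mul_div_assoc', pow_succ]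
      congr 1
      linear_combination (4 : ℚ) ^ j * 4 * P * (P - 1).descFactorial j * Q.descFactorial j * d3
    rw [key, ih]
    cases P with
    | zero =>
      simp only [Nat.cast_zero, mul_zero, zero_mul, add_zero, zero_add]
      field_simp
    | succ P =>
      rw [ih]
      simp only [Nat.add_sub_cancel]
      rw [show 2 * (P + 1) + 2 * Q + 2 * l = 2 * P + 2 * Q + 2 * l + 1 + 1 by ring,
        show 2 * (P + 1) + 2 * (Q + 1) + 2 * l = 2 * P + 2 * Q + 2 * l + 1 + 1 + 1 + 1 by ring,
        show 2 * P + 2 * Q + 2 * (l + 1) = 2 * P + 2 * Q + 2 * l + 1 + 1 by ring,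
        show P + 1 + l = P + l + 1 by ring, show P + (l + 1) = P + l + 1 by ring,
        show Q + (l + 1) = Q + l + 1 by ring, show Q + 1 + l = Q + l + 1 by ring,
        show P + 1 + Q + l = P + Q + l + 1 by ring,
        show P + Q + (l + 1) = P + Q + l + 1 by ring,
        show P + 1 + (Q + 1) + l = P + Q + l + 1 + 1 by ring,
        show 2 * (P + 1) + 2 * l = 2 * P + 2 * l + 1 + 1 by ring,
        show 2 * P + 2 * (l + 1) = 2 * P + 2 * l + 1 + 1 by ring,
        show 2 * (Q + 1) + 2 * l = 2 * Q + 2 * l + 1 + 1 by ring,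
        show 2 * Q + 2 * (l + 1) = 2 * Q + 2 * l + 1 + 1 by ring]
      simp only [Nat.factorial_succ]
      push_cast
      field_simp
      ring

/-- The combinatorial identity underlying the upper-triangular change of basis
`W[2p,2q] = Σ_ℓ (2c(λ))^{2ℓ} C₀(p,q,ℓ) V[2p−2ℓ, 2q−2ℓ]` between the scattering and
twistor bases of the Eguchi–Hanson celestial chiral algebra, with
`C₀(p,q,ℓ) = [p]_ℓ[q]_ℓ[p+q]_ℓ/(ℓ!·[2(p+q)]_{2ℓ})`. -/
theorem eh_even_basis_change (p q ℓ : ℕ) :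
    ℓ.factorial * (2 * (p + q)).descFactorial (2 * ℓ) * (2 * p).factorial * (2 * q).factorial *
        ∑ a ∈ Finset.Icc ℓ (min p q),
          4 ^ (a - ℓ) * a.choose ℓ *
            ((p + q).factorial / ((p - a).factorial * (q - a).factorial * (2 * a).factorial)) =
      (2 * p + 2 * q).factorial * p.descFactorial ℓ * q.descFactorial ℓ *
        (p + q).descFactorial ℓ := by
  by_cases hl : ℓ ≤ min p q
  swap
  · rw [Finset.Icc_eq_empty hl]
    rcases lt_or_ge p ℓ with h | h
    · simp [Nat.descFactorial_of_lt h]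
    · have h' : q < ℓ := by
        by_contra hh
        exact hl (le_min h (by omega))
      simp [Nat.descFactorial_of_lt h']
  obtain ⟨P, rfl⟩ : ∃ P, p = P + ℓ := ⟨p - ℓ, by omega⟩
  obtain ⟨Q, rfl⟩ : ∃ Q, q = Q + ℓ := ⟨q - ℓ, by omega⟩
  have hdesc : ∀ n k : ℕ, ((n + k).descFactorial k : ℚ) = (n + k).factorial / n.factorial := by
    intro n k
    have := Nat.factorial_mul_descFactorial (n := n + k) (k := k) (by omega)
    rw [Nat.add_sub_cancel] at this
    rw [← this]
    push_cast
    field_simp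
  have hsum : ((∑ a ∈ Finset.Icc ℓ (min (P + ℓ) (Q + ℓ)),
          4 ^ (a - ℓ) * a.choose ℓ * ((P + ℓ + (Q + ℓ)).factorial /
            ((P + ℓ - a).factorial * (Q + ℓ - a).factorial * (2 * a).factorial)) : ℕ) : ℚ) =
      (P + ℓ + (Q + ℓ)).factorial / (P.factorial * Q.factorial) *
      ∑ k ∈ Finset.range (Q + 1), (4 : ℚ) ^ k * (ℓ + k).choose ℓ * P.descFactorial k
        * Q.descFactorial k / (2 * ℓ + 2 * k).factorial := by
    have hr : Finset.Icc ℓ (min (P + ℓ) (Q + ℓ)) = Finset.Ico ℓ (min P Q + 1 + ℓ) := by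
      ext x
      simp only [Finset.mem_Icc, Finset.mem_Ico]
      omega
    rw [hr, Finset.sum_Ico_eq_sum_range, Nat.add_sub_cancel]
    have hs : ∑ k ∈ Finset.range (Q + 1), (4 : ℚ) ^ k * (ℓ + k).choose ℓ * P.descFactorial k
        * Q.descFactorial k / (2 * ℓ + 2 * k).factorial =
        ∑ k ∈ Finset.range (min P Q + 1), (4 : ℚ) ^ k * (ℓ + k).choose ℓ * P.descFactorial k
        * Q.descFactorial k / (2 * ℓ + 2 * k).factorial := by
      symm
      apply Finset.sum_subset
      · intro x
        simp only [Finset.mem_range]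
        omega
      · intro x hx hx'
        simp only [Finset.mem_range] at hx hx'
        have : P < x := by omega
        simp [Nat.descFactorial_of_lt this]
    rw [hs, Finset.mul_sum, Nat.cast_sum]
    apply Finset.sum_congr rfl
    intro k hk
    simp only [Finset.mem_range] at hk
    obtain ⟨A, rfl⟩ : ∃ A, P = A + k := ⟨P - k, by omega⟩
    obtain ⟨B, rfl⟩ : ∃ B, Q = B + k := ⟨Q - k, by omega⟩
    rw [hdesc, hdesc, show A + k + ℓ - (ℓ + k) = A by omega,
      show B + k + ℓ - (ℓ + k) = B by omega, show ℓ + k - ℓ = k by omega,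
      show A + k + ℓ + (B + k + ℓ) = A + B + (2 * (ℓ + k)) by ring,
      show 2 * ℓ + 2 * k = 2 * (ℓ + k) by ring]
    have hdvd : A.factorial * B.factorial * (2 * (ℓ + k)).factorial ∣
        (A + B + 2 * (ℓ + k)).factorial :=
      (mul_dvd_mul_right (Nat.factorial_mul_factorial_dvd_factorial_add A B) _).trans
        (Nat.factorial_mul_factorial_dvd_factorial_add _ _)
    rw [Nat.cast_mul, Nat.cast_div hdvd (by positivity)]
    push_cast
    field_simp
  have goal : ((ℓ.factorial * (2 * (P + ℓ + (Q + ℓ))).descFactorial (2 * ℓ) *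
      (2 * (P + ℓ)).factorial * (2 * (Q + ℓ)).factorial : ℕ) : ℚ) *
      ((∑ a ∈ Finset.Icc ℓ (min (P + ℓ) (Q + ℓ)),
          4 ^ (a - ℓ) * a.choose ℓ * ((P + ℓ + (Q + ℓ)).factorial /
            ((P + ℓ - a).factorial * (Q + ℓ - a).factorial * (2 * a).factorial)) : ℕ) : ℚ) =
      (((2 * (P + ℓ) + 2 * (Q + ℓ)).factorial * (P + ℓ).descFactorial ℓ *
        (Q + ℓ).descFactorial ℓ * (P + ℓ + (Q + ℓ)).descFactorial ℓ : ℕ) : ℚ) := by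
    rw [hsum, eh_aux]
    rw [show 2 * (P + ℓ + (Q + ℓ)) = 2 * P + 2 * Q + 2 * ℓ + 2 * ℓ by ring,
      show 2 * (P + ℓ) + 2 * (Q + ℓ) = 2 * P + 2 * Q + 2 * ℓ + 2 * ℓ by ring,
      show P + ℓ + (Q + ℓ) = P + Q + ℓ + ℓ by ring,
      show 2 * (P + ℓ) = 2 * P + 2 * ℓ by ring, show 2 * (Q + ℓ) = 2 * Q + 2 * ℓ by ring]
    push_cast
    rw [hdesc, hdesc, hdesc, hdesc]
    field_simp
  exact_mod_cast goal
end

section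
/- For all natural numbers p, q, ℓ: ℓ! · [2(p+q+1)]_{2ℓ} · (2p+1)! · (2q+1)! · Σ_{a=ℓ}^{min(p,q)} 2^{2(a−ℓ)+1} · C(a,ℓ) · (p+q+1)!/((p−a)!·(q−a)!·(2a+1)!) = (2p+2q+2)! · [p]_ℓ · [q]_ℓ · [p+q+1]_ℓ (the sum being empty, hence zero, when ℓ > min(p,q), in which case the right-hand side also vanishes). Equivalently, the odd soft-graviton generators on Eguchi–Hanson space expand in the twistor basis as W[2p+1,2q+1] = Σ_ℓ (2c(λ))^{2ℓ} C₁(p,q,ℓ) V[2p−2ℓ+1, 2q−2ℓ+1] with C₁(p,q,ℓ) = [p]_ℓ[q]_ℓ[p+q+1]_ℓ/(ℓ!·[2(p+q+1)]_{2ℓ}). -/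
lemma eh_half_choose (m k : ℕ) :
    Ring.choose ((m : ℚ) + k + 1 / 2) k =
      ((2 * (m + k) + 1).factorial : ℚ) * m.factorial /
        (4 ^ k * (m + k).factorial * (2 * m + 1).factorial * k.factorial) := by
  have key : (descPochhammer ℤ k).smeval ((m : ℚ) + k + 1 / 2) =
      ((2 * (m + k) + 1).factorial : ℚ) * m.factorial /
        (4 ^ k * (m + k).factorial * (2 * m + 1).factorial) := by
    rw [Polynomial.descPochhammer_smeval_eq_ascPochhammer,
      Polynomial.ascPochhammer_smeval_eq_eval,
      show (m : ℚ) + k + 1 / 2 - k + 1 = m + 3 / 2 by ring]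
    induction k with
    | zero => simp; field_simp
    | succ k ih =>
      rw [ascPochhammer_succ_eval, ih,
        show 2 * (m + (k + 1)) + 1 = 2 * (m + k) + 1 + 1 + 1 by ring,
        show m + (k + 1) = m + k + 1 by ring, Nat.factorial_succ (2 * (m + k) + 1 + 1),
        Nat.factorial_succ (2 * (m + k) + 1), Nat.factorial_succ (m + k), pow_succ]
      push_cast
      field_simp
      ring
  have h := Ring.descPochhammer_eq_factorial_smul_choose ((m : ℚ) + k + 1 / 2) k
  rw [key, nsmul_eq_mul] at h
  have hk : (k.factorial : ℚ) ≠ 0 := by positivity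
  rw [← div_div, h]
  field_simp

lemma eh_vand (P Q l : ℕ) :
    ∑ b ∈ Finset.range (min P Q + 1), (P.choose b : ℚ) *
      (((2 * (Q + l) + 1).factorial : ℚ) * (l + b).factorial /
        (4 ^ (Q - b) * (Q + l).factorial * (2 * (l + b) + 1).factorial * (Q - b).factorial)) =
      ((2 * (P + l + Q) + 1).factorial : ℚ) * (P + l).factorial /
        (4 ^ Q * (P + l + Q).factorial * (2 * (P + l) + 1).factorial * Q.factorial) := by
  rw [← eh_half_choose]
  have h := Ring.add_choose_eq (r := (P : ℚ)) (s := (Q : ℚ) + l + 1 / 2) Q (Commute.all _ _)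
  have e : (P : ℚ) + ((Q : ℚ) + l + 1 / 2) = ((P + l : ℕ) : ℚ) + Q + 1 / 2 := by
    push_cast; ring
  rw [e] at h
  rw [h, Finset.Nat.sum_antidiagonal_eq_sum_range_succ_mk]
  have hsub : Finset.range (min P Q + 1) ⊆ Finset.range Q.succ := by
    intro x; simp only [Finset.mem_range]; omega
  rw [← Finset.sum_subset hsub]
  · apply Finset.sum_congr rfl
    intro b hb
    simp only [Finset.mem_range] at hb
    obtain ⟨j, rfl⟩ : ∃ j, Q = j + b := ⟨Q - b, by omega⟩
    have := eh_half_choose (l + b) j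
    have e1 : (((j + b : ℕ) : ℚ) + l + 1 / 2) = ((l + b : ℕ) : ℚ) + j + 1 / 2 := by
      push_cast; ring
    simp only [Nat.add_sub_cancel]
    rw [e1, this, Ring.choose_natCast]
    rw [show l + b + j = j + b + l by omega]
  · intro b hb hb'
    simp only [Finset.mem_range] at hb hb'
    rw [Ring.choose_natCast, Nat.choose_eq_zero_of_lt (by omega)]
    simp

/-- The combinatorial identity underlying the upper-triangular change of basis
`W[2p+1,2q+1] = Σ_ℓ (2c(λ))^{2ℓ} C₁(p,q,ℓ) V[2p−2ℓ+1, 2q−2ℓ+1]` between the scattering and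
twistor bases of the Eguchi–Hanson celestial chiral algebra, with
`C₁(p,q,ℓ) = [p]_ℓ[q]_ℓ[p+q+1]_ℓ/(ℓ!·[2(p+q+1)]_{2ℓ})`. -/
theorem eh_odd_basis_change (p q ℓ : ℕ) :
    ℓ.factorial * (2 * (p + q + 1)).descFactorial (2 * ℓ) *
        (2 * p + 1).factorial * (2 * q + 1).factorial *
        ∑ a ∈ Finset.Icc ℓ (min p q),
          2 ^ (2 * (a - ℓ) + 1) * a.choose ℓ *
            ((p + q + 1).factorial /
              ((p - a).factorial * (q - a).factorial * (2 * a + 1).factorial)) =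
      (2 * p + 2 * q + 2).factorial * p.descFactorial ℓ * q.descFactorial ℓ *
        (p + q + 1).descFactorial ℓ := by
  by_cases hl : ℓ ≤ min p q
  swap
  · rw [Finset.Icc_eq_empty hl]
    rcases (by omega : p < ℓ ∨ q < ℓ) with h | h <;>
      simp [Nat.descFactorial_eq_zero_iff_lt.2 h]
  obtain ⟨P, rfl⟩ : ∃ P, p = P + ℓ := ⟨p - ℓ, by omega⟩
  obtain ⟨Q, rfl⟩ : ∃ Q, q = Q + ℓ := ⟨q - ℓ, by omega⟩
  have hI : Finset.Icc ℓ (min (P + ℓ) (Q + ℓ)) = Finset.Ico ℓ (ℓ + (min P Q + 1)) := by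
    ext x; simp only [Finset.mem_Icc, Finset.mem_Ico]; omega
  rw [hI, Finset.sum_Ico_eq_sum_range, Nat.add_sub_cancel_left]
  have hdf : ∀ a b : ℕ, ((a + b).descFactorial b : ℚ) = (a + b).factorial / a.factorial := by
    intro a b
    have := Nat.factorial_mul_descFactorial (n := a + b) (k := b) (by omega)
    rw [Nat.add_sub_cancel] at this
    rw [← this]; push_cast; field_simp
  have hV := eh_vand P Q ℓ
  have hS : ((∑ b ∈ Finset.range (min P Q + 1),
      2 ^ (2 * (ℓ + b - ℓ) + 1) * (ℓ + b).choose ℓ *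
        ((P + ℓ + (Q + ℓ) + 1).factorial /
          ((P + ℓ - (ℓ + b)).factorial * (Q + ℓ - (ℓ + b)).factorial *
            (2 * (ℓ + b) + 1).factorial)) : ℕ) : ℚ) =
      2 * 4 ^ Q * (P + ℓ + (Q + ℓ) + 1).factorial * (Q + ℓ).factorial /
        (ℓ.factorial * (2 * (Q + ℓ) + 1).factorial * P.factorial) *
      (((2 * (P + ℓ + Q) + 1).factorial : ℚ) * (P + ℓ).factorial /
        (4 ^ Q * (P + ℓ + Q).factorial * (2 * (P + ℓ) + 1).factorial * Q.factorial)) := by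
    rw [← hV, Finset.mul_sum, Nat.cast_sum]
    apply Finset.sum_congr rfl
    intro b hb
    simp only [Finset.mem_range] at hb
    obtain ⟨i, rfl⟩ : ∃ i, P = i + b := ⟨P - b, by omega⟩
    obtain ⟨j, rfl⟩ : ∃ j, Q = j + b := ⟨Q - b, by omega⟩
    rw [show i + b + ℓ - (ℓ + b) = i by omega, show j + b + ℓ - (ℓ + b) = j by omega,
      show ℓ + b - ℓ = b by omega, show j + b - b = j by omega]
    have hd : i.factorial * j.factorial * (2 * (ℓ + b) + 1).factorial ∣
        (i + b + ℓ + (j + b + ℓ) + 1).factorial := by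
      rw [show i + b + ℓ + (j + b + ℓ) + 1 = i + j + (2 * (ℓ + b) + 1) by ring]
      exact (mul_dvd_mul_right (Nat.factorial_mul_factorial_dvd_factorial_add i j) _).trans
        (Nat.factorial_mul_factorial_dvd_factorial_add _ _)
    rw [Nat.cast_mul, Nat.cast_div hd (by positivity), Nat.cast_mul, Nat.cast_add_choose,
      Nat.choose_symm_add.symm, Nat.cast_add_choose]
    push_cast
    rw [pow_succ, pow_mul, pow_add]
    norm_num
    field_simp
  have h1 : 2 * (P + ℓ + (Q + ℓ) + 1) = 2 * (P + ℓ + Q) + 1 + 1 + 2 * ℓ := by ring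
  have h2 : 2 * (P + ℓ) + 2 * (Q + ℓ) + 2 = 2 * (P + ℓ + Q) + 1 + 1 + 2 * ℓ := by ring
  have h3 : P + ℓ + (Q + ℓ) + 1 = P + ℓ + Q + 1 + ℓ := by ring
  rw [← @Nat.cast_inj ℚ, Nat.cast_mul, hS, h1, h2, h3]
  push_cast
  rw [hdf, hdf, hdf, hdf, Nat.factorial_succ (2 * (P + ℓ + Q) + 1),
    Nat.factorial_succ (P + ℓ + Q)]
  push_cast
  field_simp
  ring
end

section
/- Fix Λ ∈ ℂ and work on the domain U = {(μ₀, μ₁, λ₀, λ₁) ∈ ℂ⁴ : μ₀μ₁λ₀λ₁ ≠ 0}, with the pointwise bracket {f,g}_Λ = ∂_{μ₀}f·∂_{μ₁}g − ∂_{μ₁}f·∂_{μ₀}g + Λ(∂_{λ₀}f·∂_{λ₁}g − ∂_{λ₁}f·∂_{λ₀}g) of complex-differentiable functions. For half-integers p, m, a and q, n, b such that p+m−1, p−m−1, q+n−1, q−n−1 are nonnegative integers and p−a−2, p+a−2, q−b−2, q+b−2 are integers, define w^p_{m,a} = μ₀^{p+m−1}μ₁^{p−m−1}/(2·λ₀^{p−a−2}·λ₁^{p+a−2}).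 Then at every point of U: {w^p_{m,a}, w^q_{n,b}}_Λ = (m(q−1) − n(p−1))·w^{p+q−2}_{m+n,a+b} − Λ·(a(q−2) − b(p−2))·w^{p+q−1}_{m+n,a+b}. (This is the Λ-deformed celestial chiral algebra L ham_Λ(ℂ² × ℂ*) of self-dual gravity on AdS₄, eq. (5.12).) -/
/-- The complex partial derivative in the `i`-th coordinate of a function on `ℂ⁴`. -/
noncomputable def cpd4 (i : Fin 4) (f : (Fin 4 → ℂ) → ℂ) (z : Fin 4 → ℂ) : ℂ :=
  fderiv ℂ f z (Pi.single i 1)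

/-- The Λ-deformed bracket determined by the non-degenerate AdS₄ infinity twistor in the
ball model: `{f,g}_Λ = ∂_{μ₀}f ∂_{μ₁}g − ∂_{μ₁}f ∂_{μ₀}g
  + Λ(∂_{λ₀}f ∂_{λ₁}g − ∂_{λ₁}f ∂_{λ₀}g)`, with coordinates `(μ₀, μ₁, λ₀, λ₁)`. -/
noncomputable def lambdaBracket (Λ : ℂ) (f g : (Fin 4 → ℂ) → ℂ) (z : Fin 4 → ℂ) : ℂ :=
  cpd4 0 f z * cpd4 1 g z - cpd4 1 f z * cpd4 0 g z +
    Λ * (cpd4 2 f z * cpd4 3 g z - cpd4 3 f z * cpd4 2 g z)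

/-- The generator `μ₀^A μ₁^B / (2 λ₀^C λ₁^D)` of the celestial chiral algebra; for
`A = p+m−1`, `B = p−m−1`, `C = p−a−2`, `D = p+a−2` this is `w^p_{m,a}`. -/
noncomputable def wGen (A B C D : ℤ) (z : Fin 4 → ℂ) : ℂ :=
  z 0 ^ A * z 1 ^ B / (2 * z 2 ^ C * z 3 ^ D)

/-- A coordinate power has the expected derivative. -/
lemma coordPow_hasFDerivAt (k : Fin 4) (A : ℤ) (z : Fin 4 → ℂ) (h : z k ≠ 0) :
    HasFDerivAt (fun w : Fin 4 → ℂ => w k ^ A)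
      (((A : ℂ) * z k ^ (A - 1)) • (ContinuousLinearMap.proj k : (Fin 4 → ℂ) →L[ℂ] ℂ)) z := by
  have hp : HasFDerivAt (fun w : Fin 4 → ℂ => w k)
      (ContinuousLinearMap.proj k : (Fin 4 → ℂ) →L[ℂ] ℂ) z := hasFDerivAt_apply k z
  have hd : HasDerivAt (fun x : ℂ => x ^ A) ((A : ℂ) * z k ^ (A - 1)) (z k) :=
    hasDerivAt_zpow A (z k) (Or.inl h)
  exact HasDerivAt.comp_hasFDerivAt (h₂ := fun x : ℂ => x ^ A) z hd hp

/-- Partial derivatives of the generators are logarithmic. -/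
lemma cpd4_wGen (A B C D : ℤ) (z : Fin 4 → ℂ) (h0 : z 0 ≠ 0) (h1 : z 1 ≠ 0)
    (h2 : z 2 ≠ 0) (h3 : z 3 ≠ 0) :
    cpd4 0 (wGen A B C D) z = A * wGen A B C D z / z 0 ∧
    cpd4 1 (wGen A B C D) z = B * wGen A B C D z / z 1 ∧
    cpd4 2 (wGen A B C D) z = -C * wGen A B C D z / z 2 ∧
    cpd4 3 (wGen A B C D) z = -D * wGen A B C D z / z 3 := by
  have e : wGen A B C D = fun w : Fin 4 → ℂ =>
      (w 0 ^ A * w 1 ^ B) * (w 2 ^ (-C) * w 3 ^ (-D)) * (1 / 2 : ℂ) := by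
    funext w
    simp only [wGen, zpow_neg, div_eq_mul_inv, mul_inv]
    ring
  have H := ((((coordPow_hasFDerivAt 0 A z h0).mul (coordPow_hasFDerivAt 1 B z h1)).mul
    ((coordPow_hasFDerivAt 2 (-C) z h2).mul (coordPow_hasFDerivAt 3 (-D) z h3))).mul_const
      (1 / 2 : ℂ)).fderiv
  have e' : fderiv ℂ (wGen A B C D) z = _ := (congrArg (fun f => fderiv ℂ f z) e).trans H
  simp only [cpd4, e']
  rw [e]
  refine ⟨?_, ?_, ?_, ?_⟩ <;>
  · simp [zpow_sub_one₀, h0, h1, h2, h3]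
    try field_simp

/-- The Λ-deformed celestial chiral algebra `L ham_Λ(ℂ² × ℂ*)` of self-dual gravity on
AdS₄ (eq. (5.12)): `{w^p_{m,a}, w^q_{n,b}}_Λ = (m(q−1) − n(p−1))·w^{p+q−2}_{m+n,a+b}
  − Λ·(a(q−2) − b(p−2))·w^{p+q−1}_{m+n,a+b}`. -/
theorem lambda_deformed_CCA (Λ p m a q n b : ℂ) (A B A' B' : ℕ) (C D C' D' : ℤ)
    (hA : (A : ℂ) = p + m - 1) (hB : (B : ℂ) = p - m - 1)
    (hC : (C : ℂ) = p - a - 2) (hD : (D : ℂ) = p + a - 2)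
    (hA' : (A' : ℂ) = q + n - 1) (hB' : (B' : ℂ) = q - n - 1)
    (hC' : (C' : ℂ) = q - b - 2) (hD' : (D' : ℂ) = q + b - 2)
    (z : Fin 4 → ℂ) (hz : z 0 * z 1 * z 2 * z 3 ≠ 0) :
    lambdaBracket Λ (wGen (A : ℤ) (B : ℤ) C D) (wGen (A' : ℤ) (B' : ℤ) C' D') z =
      (m * (q - 1) - n * (p - 1)) *
          wGen ((A : ℤ) + (A' : ℤ) - 1) ((B : ℤ) + (B' : ℤ) - 1) (C + C') (D + D') z
        - Λ * (a * (q - 2) - b * (p - 2)) *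
            wGen ((A : ℤ) + (A' : ℤ)) ((B : ℤ) + (B' : ℤ)) (C + C' + 1) (D + D' + 1) z := by
  have h0 : z 0 ≠ 0 := by rintro h; simp [h] at hz
  have h1 : z 1 ≠ 0 := by rintro h; simp [h] at hz
  have h2 : z 2 ≠ 0 := by rintro h; simp [h] at hz
  have h3 : z 3 ≠ 0 := by rintro h; simp [h] at hz
  obtain ⟨a0, a1, a2, a3⟩ := cpd4_wGen A B C D z h0 h1 h2 h3
  obtain ⟨b0, b1, b2, b3⟩ := cpd4_wGen A' B' C' D' z h0 h1 h2 h3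
  have E1 : wGen ((A : ℤ) + (A' : ℤ) - 1) ((B : ℤ) + (B' : ℤ) - 1) (C + C') (D + D') z
      = 2 * wGen A B C D z * wGen A' B' C' D' z / (z 0 * z 1) := by
    simp only [wGen, zpow_sub_one₀ h0, zpow_sub_one₀ h1, zpow_add₀ h0, zpow_add₀ h1,
      zpow_add₀ h2, zpow_add₀ h3, div_eq_mul_inv, mul_inv]
    ring
  have E2 : wGen ((A : ℤ) + (A' : ℤ)) ((B : ℤ) + (B' : ℤ)) (C + C' + 1) (D + D' + 1) z
      = 2 * wGen A B C D z * wGen A' B' C' D' z / (z 2 * z 3) := by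
    simp only [wGen, zpow_add₀ h0, zpow_add₀ h1, zpow_one,
      zpow_add₀ h2, zpow_add₀ h3, div_eq_mul_inv, mul_inv]
    ring
  rw [lambdaBracket, a0, a1, a2, a3, b0, b1, b2, b3, E1, E2]
  push_cast
  rw [hA, hB, hC, hD, hA', hB', hC', hD']
  simp only [div_eq_mul_inv, mul_inv]
  ring
end

section
/- Fix Λ ∈ ℂ, a spin parameter s, and work on U = {(μ₀, μ₁, λ₀, λ₁) ∈ ℂ⁴ : μ₀μ₁λ₀λ₁ ≠ 0} with the bracket {f,g}_Λ = ∂_{μ₀}f·∂_{μ₁}g − ∂_{μ₁}f·∂_{μ₀}g + Λ(∂_{λ₀}f·∂_{λ₁}g − ∂_{λ₁}f·∂_{λ₀}g). Define w^p_{m,a} = μ₀^{p+m−1}μ₁^{p−m−1}/(2·λ₀^{p−a−2}·λ₁^{p+a−2}) and the spin-s matter modes x^q_{n,b} = μ₀^{q+n−1}μ₁^{q−n−1}/(2·λ₀^{q−b−s}·λ₁^{q+b−s}), for half-integer labels such that all μ-exponents are nonnegative integers and all λ-exponents are integers. Then at every point of U: {w^p_{m,a}, x^q_{n,b}}_Λ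 = (m(q−1) − n(p−1))·x^{p+q−2}_{m+n,a+b} − Λ·(a(q−s) − b(p−2))·x^{p+q−1}_{m+n,a+b}. (This exhibits the modes of a free spin-s field on AdS₄ as a module for the Λ-deformed celestial chiral algebra, with structure constants explicitly depending on s, eq. (5.17).) -/
theorem wGen_hasFDerivAt (A B C D : ℤ) (z : Fin 4 → ℂ) (h0 : z 0 ≠ 0) (h1 : z 1 ≠ 0)
    (h2 : z 2 ≠ 0) (h3 : z 3 ≠ 0) :
    HasFDerivAt (wGen A B C D)
      (wGen A B C D z •
        (((A : ℂ) / z 0) • (ContinuousLinearMap.proj 0 : (Fin 4 → ℂ) →L[ℂ] ℂ)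
        + ((B : ℂ) / z 1) • (ContinuousLinearMap.proj 1 : (Fin 4 → ℂ) →L[ℂ] ℂ)
        - ((C : ℂ) / z 2) • (ContinuousLinearMap.proj 2 : (Fin 4 → ℂ) →L[ℂ] ℂ)
        - ((D : ℂ) / z 3) • (ContinuousLinearMap.proj 3 : (Fin 4 → ℂ) →L[ℂ] ℂ))) z := by
  have key : ∀ (i : Fin 4) (N : ℤ), z i ≠ 0 → HasFDerivAt (fun w : Fin 4 → ℂ => w i ^ N)
      (((N : ℂ) * z i ^ (N - 1)) • (ContinuousLinearMap.proj i : (Fin 4 → ℂ) →L[ℂ] ℂ)) z := by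
    intro i N hi
    exact (hasDerivAt_zpow N (z i) (Or.inl hi)).comp_hasFDerivAt z
      (ContinuousLinearMap.proj i : (Fin 4 → ℂ) →L[ℂ] ℂ).hasFDerivAt
  have H := (((key 0 A h0).mul (key 1 B h1)).mul ((key 2 (-C) h2).mul (key 3 (-D) h3))).const_mul
    (2⁻¹ : ℂ)
  have e : wGen A B C D = fun w : Fin 4 → ℂ =>
      (2⁻¹ : ℂ) * ((w 0 ^ A * w 1 ^ B) * (w 2 ^ (-C) * w 3 ^ (-D))) := by
    funext w
    simp only [wGen, zpow_neg, div_eq_mul_inv, mul_inv]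
    ring
  rw [e]
  refine H.congr_fderiv ?_
  ext v
  simp only [zpow_sub_one₀ h0, zpow_sub_one₀ h1, zpow_sub_one₀ h2, zpow_sub_one₀ h3]
  simp
  ring

theorem wGen_cpd4 (A B C D : ℤ) (z : Fin 4 → ℂ) (h0 : z 0 ≠ 0) (h1 : z 1 ≠ 0)
    (h2 : z 2 ≠ 0) (h3 : z 3 ≠ 0) :
    cpd4 0 (wGen A B C D) z = wGen A B C D z * (A / z 0) ∧
    cpd4 1 (wGen A B C D) z = wGen A B C D z * (B / z 1) ∧
    cpd4 2 (wGen A B C D) z = - (wGen A B C D z * (C / z 2)) ∧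
    cpd4 3 (wGen A B C D) z = - (wGen A B C D z * (D / z 3)) := by
  simp [cpd4, (wGen_hasFDerivAt A B C D z h0 h1 h2 h3).fderiv]

/-- The modes of a free spin-`s` field on AdS₄ form a module for the Λ-deformed celestial
chiral algebra (eq. (5.17)): `{w^p_{m,a}, x^q_{n,b}}_Λ = (m(q−1) − n(p−1))·x^{p+q−2}_{m+n,a+b}
  − Λ·(a(q−s) − b(p−2))·x^{p+q−1}_{m+n,a+b}`. -/
theorem lambda_deformed_CCA_spin_module (Λ s p m a q n b : ℂ)
    (A B A' B' : ℕ) (C D C' D' : ℤ)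
    (hA : (A : ℂ) = p + m - 1) (hB : (B : ℂ) = p - m - 1)
    (hC : (C : ℂ) = p - a - 2) (hD : (D : ℂ) = p + a - 2)
    (hA' : (A' : ℂ) = q + n - 1) (hB' : (B' : ℂ) = q - n - 1)
    (hC' : (C' : ℂ) = q - b - s) (hD' : (D' : ℂ) = q + b - s)
    (z : Fin 4 → ℂ) (hz : z 0 * z 1 * z 2 * z 3 ≠ 0) :
    lambdaBracket Λ (wGen (A : ℤ) (B : ℤ) C D) (wGen (A' : ℤ) (B' : ℤ) C' D') z =
      (m * (q - 1) - n * (p - 1)) *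
          wGen ((A : ℤ) + (A' : ℤ) - 1) ((B : ℤ) + (B' : ℤ) - 1) (C + C') (D + D') z
        - Λ * (a * (q - s) - b * (p - 2)) *
            wGen ((A : ℤ) + (A' : ℤ)) ((B : ℤ) + (B' : ℤ)) (C + C' + 1) (D + D' + 1) z := by
  have h3 : z 3 ≠ 0 := right_ne_zero_of_mul hz
  have h012 := left_ne_zero_of_mul hz
  have h2 : z 2 ≠ 0 := right_ne_zero_of_mul h012
  have h01 := left_ne_zero_of_mul h012
  have h1 : z 1 ≠ 0 := right_ne_zero_of_mul h01
  have h0 : z 0 ≠ 0 := left_ne_zero_of_mul h01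
  obtain ⟨a0, a1, a2, a3⟩ := wGen_cpd4 A B C D z h0 h1 h2 h3
  obtain ⟨b0, b1, b2, b3⟩ := wGen_cpd4 A' B' C' D' z h0 h1 h2 h3
  have e1 : wGen ((A : ℤ) + (A' : ℤ) - 1) ((B : ℤ) + (B' : ℤ) - 1) (C + C') (D + D') z
      = 2 * (wGen A B C D z * wGen A' B' C' D' z) * ((z 0)⁻¹ * (z 1)⁻¹) := by
    simp only [wGen, zpow_sub_one₀ h0, zpow_sub_one₀ h1, zpow_add₀ h0, zpow_add₀ h1,
      zpow_add₀ h2, zpow_add₀ h3, div_eq_mul_inv, mul_inv]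
    ring
  have e2 : wGen ((A : ℤ) + (A' : ℤ)) ((B : ℤ) + (B' : ℤ)) (C + C' + 1) (D + D' + 1) z
      = 2 * (wGen A B C D z * wGen A' B' C' D' z) * ((z 2)⁻¹ * (z 3)⁻¹) := by
    simp only [wGen, zpow_add_one₀ h2, zpow_add_one₀ h3, zpow_add₀ h0, zpow_add₀ h1,
      zpow_add₀ h2, zpow_add₀ h3, div_eq_mul_inv, mul_inv]
    ring
  rw [e1, e2, lambdaBracket, a0, a1, a2, a3, b0, b1, b2, b3]
  simp only [Int.cast_natCast, hA, hB, hC, hD, hA', hB', hC', hD', div_eq_mul_inv]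
  ring
end

section
/- Work on U = {(μ⁰, μ¹, λ₀, λ₁) ∈ ℂ⁴ : μ⁰μ¹λ₀λ₁ ≠ 0} with the pointwise bracket {f,g}^P = (∂_{λ₀}f·∂_{μ⁰}g − ∂_{μ⁰}f·∂_{λ₀}g) + (∂_{λ₁}f·∂_{μ¹}g − ∂_{μ¹}f·∂_{λ₁}g) of complex-differentiable functions (the Poincaré-patch infinity-twistor bracket, after absorbing the overall factor √Λ into the generators). For half-integers p, m, a and q, n, b such that p+m−1, p−m−1, q+n−1, q−n−1 are nonnegative integers and p−a−2, p+a−2, q−b−2, q+b−2 are integers, define ŵ^p_{m,a} = μ⁰^{p+m−1}μ¹^{p−m−1}/(λ₀^{p−a−2}·λ₁^{p+a−2}). Then at every point of U: {ŵ^p_{m,a}, ŵ^q_{n,b}}^P = ((p+m−1)(q−b−2) − (q+n−1)(p−a−2))·ŵ^{p+q−3/2}_{m+n−1/2, a+b−1/2} + ((p−m−1)(q+b−2) − (q−n−1)(p+a−2))·ŵ^{p+q−3/2}_{m+n+1/2, a+b+1/2}. (This is the celestial chiral algebra, eq. (5.15), adapted to the Poincaré half-space model of Euclidean AdS₄; it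 is not isomorphic to the ball-model algebra.) -/
/-- The Poincaré-patch infinity-twistor bracket (after absorbing `√Λ` into the generators):
`{f,g}^P = (∂_{λ₀}f ∂_{μ⁰}g − ∂_{μ⁰}f ∂_{λ₀}g) + (∂_{λ₁}f ∂_{μ¹}g − ∂_{μ¹}f ∂_{λ₁}g)`,
with coordinates `(μ⁰, μ¹, λ₀, λ₁)`. -/
noncomputable def poincareBracket (f g : (Fin 4 → ℂ) → ℂ) (z : Fin 4 → ℂ) : ℂ :=
  (cpd4 2 f z * cpd4 0 g z - cpd4 0 f z * cpd4 2 g z) +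
    (cpd4 3 f z * cpd4 1 g z - cpd4 1 f z * cpd4 3 g z)

/-- The generator `ŵ^p_{m,a} = μ⁰^A μ¹^B / (λ₀^C λ₁^D)` with `A = p+m−1`, `B = p−m−1`,
`C = p−a−2`, `D = p+a−2`. -/
noncomputable def wHat (A B C D : ℤ) (z : Fin 4 → ℂ) : ℂ :=
  z 0 ^ A * z 1 ^ B / (z 2 ^ C * z 3 ^ D)

theorem wHat_cpd4 (A B C D : ℤ) (z : Fin 4 → ℂ) (h0 : z 0 ≠ 0) (h1 : z 1 ≠ 0)
    (h2 : z 2 ≠ 0) (h3 : z 3 ≠ 0) :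
    cpd4 0 (wHat A B C D) z = A * wHat A B C D z / z 0 ∧
    cpd4 1 (wHat A B C D) z = B * wHat A B C D z / z 1 ∧
    cpd4 2 (wHat A B C D) z = -C * wHat A B C D z / z 2 ∧
    cpd4 3 (wHat A B C D) z = -D * wHat A B C D z / z 3 := by
  have e : wHat A B C D =
      fun z : Fin 4 → ℂ => (z 0 ^ A * z 1 ^ B) * (z 2 ^ (-C) * z 3 ^ (-D)) := by
    funext z
    simp only [wHat, zpow_neg, div_eq_mul_inv, mul_inv]
  have key : ∀ (i : Fin 4) (N : ℤ), z i ≠ 0 →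
      HasFDerivAt (fun z : Fin 4 → ℂ => z i ^ N)
        (((N : ℂ) * z i ^ (N - 1)) • (ContinuousLinearMap.proj i : (Fin 4 → ℂ) →L[ℂ] ℂ)) z :=
    by
      intro i N h
      have a1 : HasFDerivAt (fun z : Fin 4 → ℂ => z i)
          (ContinuousLinearMap.proj i : (Fin 4 → ℂ) →L[ℂ] ℂ) z :=
        (ContinuousLinearMap.proj i : (Fin 4 → ℂ) →L[ℂ] ℂ).hasFDerivAt
      exact HasDerivAt.comp_hasFDerivAt (h₂ := fun x : ℂ => x ^ N) z
        (hasDerivAt_zpow N (z i) (Or.inl h)) a1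
  have H := ((key 0 A h0).mul (key 1 B h1)).mul ((key 2 (-C) h2).mul (key 3 (-D) h3))
  have F := H.fderiv
  rw [e]
  simp only [cpd4]
  have F' : fderiv ℂ (fun z : Fin 4 → ℂ => (z 0 ^ A * z 1 ^ B) * (z 2 ^ (-C) * z 3 ^ (-D))) z = _ := F
  rw [F']
  refine ⟨?_, ?_, ?_, ?_⟩ <;>
  · simp [zpow_sub_one₀ h0, zpow_sub_one₀ h1, zpow_sub_one₀ h2, zpow_sub_one₀ h3]
    try ring

/-- The celestial chiral algebra adapted to the Poincaré half-space model of Euclidean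
AdS₄ (eq. (5.15)): `{ŵ^p_{m,a}, ŵ^q_{n,b}}^P
  = ((p+m−1)(q−b−2) − (q+n−1)(p−a−2))·ŵ^{p+q−3/2}_{m+n−1/2, a+b−1/2}
  + ((p−m−1)(q+b−2) − (q−n−1)(p+a−2))·ŵ^{p+q−3/2}_{m+n+1/2, a+b+1/2}`. -/
theorem poincare_CCA (p m a q n b : ℂ) (A B A' B' : ℕ) (C D C' D' : ℤ)
    (hA : (A : ℂ) = p + m - 1) (hB : (B : ℂ) = p - m - 1)
    (hC : (C : ℂ) = p - a - 2) (hD : (D : ℂ) = p + a - 2)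
    (hA' : (A' : ℂ) = q + n - 1) (hB' : (B' : ℂ) = q - n - 1)
    (hC' : (C' : ℂ) = q - b - 2) (hD' : (D' : ℂ) = q + b - 2)
    (z : Fin 4 → ℂ) (hz : z 0 * z 1 * z 2 * z 3 ≠ 0) :
    poincareBracket (wHat (A : ℤ) (B : ℤ) C D) (wHat (A' : ℤ) (B' : ℤ) C' D') z =
      ((p + m - 1) * (q - b - 2) - (q + n - 1) * (p - a - 2)) *
          wHat ((A : ℤ) + (A' : ℤ) - 1) ((B : ℤ) + (B' : ℤ)) (C + C' + 1) (D + D') z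
        + ((p - m - 1) * (q + b - 2) - (q - n - 1) * (p + a - 2)) *
            wHat ((A : ℤ) + (A' : ℤ)) ((B : ℤ) + (B' : ℤ) - 1) (C + C') (D + D' + 1) z := by
  have h3 : z 3 ≠ 0 := right_ne_zero_of_mul hz
  have hz2 := left_ne_zero_of_mul hz
  have h2 : z 2 ≠ 0 := right_ne_zero_of_mul hz2
  have hz1 := left_ne_zero_of_mul hz2
  have h1 : z 1 ≠ 0 := right_ne_zero_of_mul hz1
  have h0 : z 0 ≠ 0 := left_ne_zero_of_mul hz1
  obtain ⟨f0, f1, f2, f3⟩ := wHat_cpd4 A B C D z h0 h1 h2 h3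
  obtain ⟨g0, g1, g2, g3⟩ := wHat_cpd4 A' B' C' D' z h0 h1 h2 h3
  have E1 : wHat ((A : ℤ) + (A' : ℤ) - 1) ((B : ℤ) + (B' : ℤ)) (C + C' + 1) (D + D') z =
      wHat A B C D z * wHat A' B' C' D' z / (z 0 * z 2) := by
    simp only [wHat, zpow_sub_one₀ h0, zpow_add₀ h0, zpow_add₀ h1, zpow_add₀ h2, zpow_add₀ h3,
      zpow_one, div_eq_mul_inv, mul_inv]
    ring
  have E2 : wHat ((A : ℤ) + (A' : ℤ)) ((B : ℤ) + (B' : ℤ) - 1) (C + C') (D + D' + 1) z =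
      wHat A B C D z * wHat A' B' C' D' z / (z 1 * z 3) := by
    simp only [wHat, zpow_sub_one₀ h1, zpow_add₀ h0, zpow_add₀ h1, zpow_add₀ h2, zpow_add₀ h3,
      zpow_one, div_eq_mul_inv, mul_inv]
    ring
  rw [poincareBracket, f0, f1, f2, f3, g0, g1, g2, g3, E1, E2, ← hA, ← hB, ← hC, ← hD, ← hA',
    ← hB', ← hC', ← hD']
  push_cast
  simp only [div_eq_mul_inv, mul_inv]
  ring
end

section
/- Let Λ, ν, η ∈ ℂ and let (λ₁, λ₂) ∈ ℂ² with (λ₁, λ₂) ≠ (0,0); set ρ = |λ₁|² + |λ₂|², K = Λν²η²/2, and define X = λ₁² − K·(conj λ₂)²/ρ², Y = λ₂² − K·(conj λ₁)²/ρ², Z = λ₁λ₂ + K·(conj λ₁)(conj λ₂)/ρ². Then X·Y − Z² = −(Λν²/2)·η². (Hence the deformed holomorphic coordinates Y^{αβ} = λ^αλ^β − (Λν²η²/2)·λ̂^αλ̂^β/⟨λ λ̂⟩² produced by the backreaction with cosmological constant satisfy Y^{αβ}Y_{αβ} = −Λν²η², so the backreacted twistor space fibres over the quadric Q_{Λν²}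 = {XY − Z² + (Λν²/2)η² = 0} ≅ ℂP¹ × ℂP¹, the minitwistor space appearing in Pedersen's twistor construction.) -/
/-- The deformed holomorphic coordinates of the backreaction with cosmological constant
satisfy `X·Y − Z² = −(Λν²/2)·η²`, exhibiting the fibration of the backreacted twistor
space over the quadric `Q_{Λν²} ≅ ℂP¹ × ℂP¹` of Pedersen's construction. -/
theorem pedersen_quadric (Λ ν η la1 la2 ρ K : ℂ) (h : (la1, la2) ≠ ((0 : ℂ), (0 : ℂ)))
    (hρ : ρ = la1 * (starRingEnd ℂ) la1 + la2 * (starRingEnd ℂ) la2)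
    (hK : K = Λ * ν ^ 2 * η ^ 2 / 2) :
    (la1 ^ 2 - K * ((starRingEnd ℂ) la2) ^ 2 / ρ ^ 2) *
        (la2 ^ 2 - K * ((starRingEnd ℂ) la1) ^ 2 / ρ ^ 2) -
      (la1 * la2 + K * (starRingEnd ℂ) la1 * (starRingEnd ℂ) la2 / ρ ^ 2) ^ 2 =
      -(Λ * ν ^ 2 / 2) * η ^ 2 := by
  have hρ0 : ρ ≠ 0 := by
    intro h0
    apply h
    rw [hρ, Complex.mul_conj, Complex.mul_conj] at h0
    have h1 : Complex.normSq la1 + Complex.normSq la2 = 0 := by exact_mod_cast h0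
    have n1 := Complex.normSq_nonneg la1
    have n2 := Complex.normSq_nonneg la2
    have e1 : la1 = 0 := Complex.normSq_eq_zero.mp (by linarith)
    have e2 : la2 = 0 := Complex.normSq_eq_zero.mp (by linarith)
    rw [e1, e2]
  have ht : (ρ ^ 2)⁻¹ * ρ ^ 2 = 1 := inv_mul_cancel₀ (pow_ne_zero 2 hρ0)
  simp only [div_eq_mul_inv _ (ρ ^ 2)]
  generalize (ρ ^ 2)⁻¹ = t at ht ⊢
  have hK' : -(Λ * ν ^ 2 / 2) * η ^ 2 = -K := by rw [hK]; ring
  rw [hK']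
  rw [hρ] at ht
  linear_combination (-K) * ht
end

section
/- Fix Λ, ν ∈ ℂ and work on the torus T = {(u, v, X, Y, Z) ∈ ℂ⁵ : u·v·X·Y·Z ≠ 0}, with the pointwise bracket of complex-differentiable functions {f,g} = (∂_u f·∂_v g − ∂_v f·∂_u g) + 2ΛX(∂_X f·∂_Z g − ∂_Z f·∂_X g) − 2ΛY(∂_Y f·∂_Z g − ∂_Z f·∂_Y g) + 4ΛZ(∂_X f·∂_Y g − ∂_Y f·∂_X g) + (Λν²/2)·uv·[(v/X)(∂_v f·∂_Y g − ∂_Y f·∂_v g) + (v/Y)(∂_v f·∂_X g − ∂_X f·∂_v g) − (u/X)(∂_u f·∂_Y g − ∂_Y f·∂_u g) − (u/Y)(∂_u f·∂_X g − ∂_X f·∂_u g)] (eq. (6.28), with u = φ⁺, v = φ⁻, η = uv). Then for all integers p,q,i,j,k,r,s,l,m,n the Laurent monomials w[p,q,i,j,k] = u^p v^q X^i Y^j Z^k satisfy, at every point of T: {w[p,q,i,j,k], w[r,s,l,m,n]} = (ps − qr)·w[p+r−1, q+s−1, i+l, j+m, k+n] + 2Λ((i−j)n − (l−m)k)·w[p+r,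 q+s, i+l, j+m, k+n−1] + 4Λ(im − jl)·w[p+r, q+s, i+l−1, j+m−1, k+n+1] − (Λν²/2)((p−q)(l+m) − (r−s)(i+j))·w[p+r+1, q+s+1, i+l−1, j+m−1, k+n]. (This is eq. (6.29), the bracket underlying the two-parameter deformation of the celestial chiral algebra on the self-dual Taub-NUT–AdS/Pedersen background.) -/
/-- The complex partial derivative in the `i`-th coordinate of a function on `ℂ⁵`. -/
noncomputable def cpd5 (i : Fin 5) (f : (Fin 5 → ℂ) → ℂ) (z : Fin 5 → ℂ) : ℂ :=
  fderiv ℂ f z (Pi.single i 1)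

/-- The bracket of eq. (6.28), in coordinates `(u, v, X, Y, Z) = (z 0, z 1, z 2, z 3, z 4)`:
`{f,g} = (∂_u f ∂_v g − ∂_v f ∂_u g) + 2ΛX(∂_X f ∂_Z g − ∂_Z f ∂_X g)
  − 2ΛY(∂_Y f ∂_Z g − ∂_Z f ∂_Y g) + 4ΛZ(∂_X f ∂_Y g − ∂_Y f ∂_X g)
  + (Λν²/2)·uv·[(v/X)(∂_v f ∂_Y g − ∂_Y f ∂_v g) + (v/Y)(∂_v f ∂_X g − ∂_X f ∂_v g)
    − (u/X)(∂_u f ∂_Y g − ∂_Y f ∂_u g) − (u/Y)(∂_u f ∂_X g − ∂_X f ∂_u g)]`. -/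
noncomputable def pedersenBracket (Λ ν : ℂ) (f g : (Fin 5 → ℂ) → ℂ) (z : Fin 5 → ℂ) : ℂ :=
  (cpd5 0 f z * cpd5 1 g z - cpd5 1 f z * cpd5 0 g z)
    + 2 * Λ * z 2 * (cpd5 2 f z * cpd5 4 g z - cpd5 4 f z * cpd5 2 g z)
    - 2 * Λ * z 3 * (cpd5 3 f z * cpd5 4 g z - cpd5 4 f z * cpd5 3 g z)
    + 4 * Λ * z 4 * (cpd5 2 f z * cpd5 3 g z - cpd5 3 f z * cpd5 2 g z)
    + Λ * ν ^ 2 / 2 * (z 0 * z 1) *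
        ((z 1 / z 2) * (cpd5 1 f z * cpd5 3 g z - cpd5 3 f z * cpd5 1 g z)
          + (z 1 / z 3) * (cpd5 1 f z * cpd5 2 g z - cpd5 2 f z * cpd5 1 g z)
          - (z 0 / z 2) * (cpd5 0 f z * cpd5 3 g z - cpd5 3 f z * cpd5 0 g z)
          - (z 0 / z 3) * (cpd5 0 f z * cpd5 2 g z - cpd5 2 f z * cpd5 0 g z))

/-- The Laurent monomial `w[p,q,i,j,k] = u^p v^q X^i Y^j Z^k`. -/
noncomputable def wLaurent (p q i j k : ℤ) (z : Fin 5 → ℂ) : ℂ :=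
  z 0 ^ p * z 1 ^ q * z 2 ^ i * z 3 ^ j * z 4 ^ k

/-- All five partial derivatives of a Laurent monomial, from its total derivative. -/
lemma wLaurent_cpd5 (p q i j k : ℤ) (z : Fin 5 → ℂ) (h0 : z 0 ≠ 0) (h1 : z 1 ≠ 0)
    (h2 : z 2 ≠ 0) (h3 : z 3 ≠ 0) (h4 : z 4 ≠ 0) :
    cpd5 0 (wLaurent p q i j k) z = p * wLaurent p q i j k z / z 0 ∧
    cpd5 1 (wLaurent p q i j k) z = q * wLaurent p q i j k z / z 1 ∧
    cpd5 2 (wLaurent p q i j k) z = i * wLaurent p q i j k z / z 2 ∧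
    cpd5 3 (wLaurent p q i j k) z = j * wLaurent p q i j k z / z 3 ∧
    cpd5 4 (wLaurent p q i j k) z = k * wLaurent p q i j k z / z 4 := by
  have key : ∀ (a : Fin 5) (e : ℤ), z a ≠ 0 →
      HasFDerivAt (fun y : Fin 5 → ℂ => y a ^ e)
        (((e : ℂ) * z a ^ (e - 1)) • ContinuousLinearMap.proj (R := ℂ) (φ := fun _ => ℂ) a) z := by
    intro a e ha
    have hp : HasFDerivAt (fun y : Fin 5 → ℂ => y a)
        (ContinuousLinearMap.proj (R := ℂ) (φ := fun _ => ℂ) a) z := hasFDerivAt_apply a z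
    exact HasDerivAt.comp_hasFDerivAt (h₂ := fun x : ℂ => x ^ e) z
      (hasDerivAt_zpow e (z a) (Or.inl ha)) hp
  have H := ((((key 0 p h0).mul (key 1 q h1)).mul (key 2 i h2)).mul (key 3 j h3)).mul (key 4 k h4)
  have H' : fderiv ℂ (wLaurent p q i j k) z = _ := HasFDerivAt.fderiv H
  unfold cpd5
  rw [H']
  refine ⟨?_, ?_, ?_, ?_, ?_⟩ <;>
  · simp [wLaurent, zpow_sub_one₀, h0, h1, h2, h3, h4]
    try ring

/-- Eq. (6.29): the bracket of Laurent monomials underlying the two-parameter deformation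
of the celestial chiral algebra on the self-dual Taub-NUT–AdS/Pedersen background. -/
theorem pedersen_bracket_monomials (Λ ν : ℂ) (p q i j k r s l m n : ℤ)
    (z : Fin 5 → ℂ) (hz : z 0 * z 1 * z 2 * z 3 * z 4 ≠ 0) :
    pedersenBracket Λ ν (wLaurent p q i j k) (wLaurent r s l m n) z =
      ((p * s - q * r : ℤ) : ℂ) * wLaurent (p + r - 1) (q + s - 1) (i + l) (j + m) (k + n) z
        + 2 * Λ * (((i - j) * n - (l - m) * k : ℤ) : ℂ) *
            wLaurent (p + r) (q + s) (i + l) (j + m) (k + n - 1) z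
        + 4 * Λ * ((i * m - j * l : ℤ) : ℂ) *
            wLaurent (p + r) (q + s) (i + l - 1) (j + m - 1) (k + n + 1) z
        - Λ * ν ^ 2 / 2 * (((p - q) * (l + m) - (r - s) * (i + j) : ℤ) : ℂ) *
            wLaurent (p + r + 1) (q + s + 1) (i + l - 1) (j + m - 1) (k + n) z := by
  have h4 : z 4 ≠ 0 := right_ne_zero_of_mul hz
  have hz3 := left_ne_zero_of_mul hz
  have h3 : z 3 ≠ 0 := right_ne_zero_of_mul hz3
  have hz2 := left_ne_zero_of_mul hz3
  have h2 : z 2 ≠ 0 := right_ne_zero_of_mul hz2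
  have hz1 := left_ne_zero_of_mul hz2
  have h1 : z 1 ≠ 0 := right_ne_zero_of_mul hz1
  have h0 : z 0 ≠ 0 := left_ne_zero_of_mul hz1
  obtain ⟨a0, a1, a2, a3, a4⟩ := wLaurent_cpd5 p q i j k z h0 h1 h2 h3 h4
  obtain ⟨b0, b1, b2, b3, b4⟩ := wLaurent_cpd5 r s l m n z h0 h1 h2 h3 h4
  unfold pedersenBracket
  rw [a0, a1, a2, a3, a4, b0, b1, b2, b3, b4]
  simp only [wLaurent, zpow_sub_one₀ h0, zpow_sub_one₀ h1, zpow_sub_one₀ h2, zpow_sub_one₀ h3,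
    zpow_sub_one₀ h4, zpow_add₀ h0, zpow_add₀ h1, zpow_add₀ h2, zpow_add₀ h3, zpow_add₀ h4,
    zpow_one]
  push_cast
  generalize z 0 ^ p = A0
  generalize z 1 ^ q = A1
  generalize z 2 ^ i = A2
  generalize z 3 ^ j = A3
  generalize z 4 ^ k = A4
  generalize z 0 ^ r = B0
  generalize z 1 ^ s = B1
  generalize z 2 ^ l = B2
  generalize z 3 ^ m = B3
  generalize z 4 ^ n = B4
  field_simp
  ring
end

section
/- Fix Λ, ν ∈ ℂ and let V be the free ℂ-vector space with basis {w[p,q,i,j,k] : (p,q,i,j,k) ∈ ℤ⁵} (for instance finitely supported functions ℤ⁵ →₀ ℂ). Define a bilinear bracket on V by setting, on basis vectors, {w[p,q,i,j,k], w[r,s,l,m,n]} = (ps − qr)·w[p+r−1, q+s−1, i+l, j+m, k+n] + 2Λ((i−j)n − (l−m)k)·w[p+r, q+s, i+l, j+m, k+n−1] + 4Λ(im − jl)·w[p+r, q+s, i+l−1, j+m−1, k+n+1] − (Λν²/2)((p−q)(l+m) − (r−s)(i+j))·w[p+r+1, q+s+1, i+l−1, j+m−1, k+n], extended bilinearly.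 Then this bracket is antisymmetric and satisfies the Jacobi identity {a,{b,c}} + {b,{c,a}} + {c,{a,b}} = 0 for all a,b,c ∈ V; hence V is a complex Lie algebra (the two-parameter deformation, eq. (6.29), of the loop algebra of the wedge subalgebra of w_{1+∞} associated to self-dual gravity on the Pedersen/self-dual Taub-NUT–AdS background). -/
/-- The structure constants of the two-parameter deformation (eq. (6.29)) of the loop
algebra of the wedge subalgebra of `w_{1+∞}`, on basis vectors `w[p,q,i,j,k]` indexed by
`ℤ⁵`. -/
noncomputable def pedersenStruct (Λ ν : ℂ) :
    (ℤ × ℤ × ℤ × ℤ × ℤ) → (ℤ × ℤ × ℤ × ℤ × ℤ) → ((ℤ × ℤ × ℤ × ℤ × ℤ) →₀ ℂ)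
  | (p, q, i, j, k), (r, s, l, m, n) =>
      ((p * s - q * r : ℤ) : ℂ) •
          Finsupp.single (p + r - 1, q + s - 1, i + l, j + m, k + n) (1 : ℂ)
        + (2 * Λ * (((i - j) * n - (l - m) * k : ℤ) : ℂ)) •
            Finsupp.single (p + r, q + s, i + l, j + m, k + n - 1) (1 : ℂ)
        + (4 * Λ * ((i * m - j * l : ℤ) : ℂ)) •
            Finsupp.single (p + r, q + s, i + l - 1, j + m - 1, k + n + 1) (1 : ℂ)
        - (Λ * ν ^ 2 / 2 * (((p - q) * (l + m) - (r - s) * (i + j) : ℤ) : ℂ)) •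
            Finsupp.single (p + r + 1, q + s + 1, i + l - 1, j + m - 1, k + n) (1 : ℂ)

/-- The unique `ℂ`-bilinear extension of the structure constants to the free vector space
on the basis `{w[p,q,i,j,k] : (p,q,i,j,k) ∈ ℤ⁵}`. -/
noncomputable def pedersenLieBracket (Λ ν : ℂ)
    (f g : (ℤ × ℤ × ℤ × ℤ × ℤ) →₀ ℂ) : (ℤ × ℤ × ℤ × ℤ × ℤ) →₀ ℂ :=
  f.sum fun x cx => g.sum fun y cy => (cx * cy) • pedersenStruct Λ ν x y

noncomputable def pedB (Λ ν : ℂ) : ((ℤ × ℤ × ℤ × ℤ × ℤ) →₀ ℂ) →ₗ[ℂ]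
    ((ℤ × ℤ × ℤ × ℤ × ℤ) →₀ ℂ) →ₗ[ℂ] ((ℤ × ℤ × ℤ × ℤ × ℤ) →₀ ℂ) :=
  Finsupp.linearCombination ℂ (fun x => Finsupp.linearCombination ℂ (pedersenStruct Λ ν x))

theorem pedB_eq (Λ ν : ℂ) (f g : (ℤ × ℤ × ℤ × ℤ × ℤ) →₀ ℂ) :
    pedersenLieBracket Λ ν f g = pedB Λ ν f g := by
  simp only [pedersenLieBracket, pedB, Finsupp.linearCombination_apply, Finsupp.sum,
    LinearMap.sum_apply, LinearMap.smul_apply, Finset.smul_sum, mul_smul]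

theorem pedB_single (Λ ν : ℂ) (x y : ℤ × ℤ × ℤ × ℤ × ℤ) :
    pedB Λ ν (Finsupp.single x 1) (Finsupp.single y 1) = pedersenStruct Λ ν x y := by
  simp [pedB]

theorem ped_anti (Λ ν : ℂ) (x y : ℤ × ℤ × ℤ × ℤ × ℤ) :
    pedersenStruct Λ ν x y = -pedersenStruct Λ ν y x := by
  obtain ⟨p, q, i, j, k⟩ := x
  obtain ⟨r, s, l, m, n⟩ := y
  simp only [pedersenStruct]
  rw [add_comm r p, add_comm s q, add_comm l i, add_comm m j, add_comm n k]
  push_cast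
  module

set_option maxHeartbeats 4000000 in
theorem ped_jac (Λ ν : ℂ) (x y z : ℤ × ℤ × ℤ × ℤ × ℤ) :
    pedB Λ ν (Finsupp.single x 1) (pedersenStruct Λ ν y z)
      + pedB Λ ν (Finsupp.single y 1) (pedersenStruct Λ ν z x)
      + pedB Λ ν (Finsupp.single z 1) (pedersenStruct Λ ν x y) = 0 := by
  obtain ⟨p, q, i, j, k⟩ := x
  obtain ⟨r, s, l, m, n⟩ := y
  obtain ⟨t, u, a, b, c⟩ := z
  simp only [pedersenStruct, map_add, map_sub, map_smul, pedB_single]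
  ext w
  simp only [Finsupp.add_apply, Finsupp.sub_apply, Finsupp.smul_apply, smul_eq_mul,
    Finsupp.zero_apply]
  obtain ⟨F, hF⟩ : ∃ F : ℤ → ℤ → ℤ → ℤ → ℤ → ℂ, ∀ a b c d e,
      (Finsupp.single (a, b, c, d, e) (1 : ℂ)) w = F a b c d e := ⟨_, fun _ _ _ _ _ => rfl⟩
  simp only [hF]
  clear hF
  push_cast
  ring_nf

theorem ped_ext {P : ((ℤ × ℤ × ℤ × ℤ × ℤ) →₀ ℂ) → Prop} (h0 : P 0)
    (ha : ∀ f g, P f → P g → P (f + g)) (hs : ∀ (c : ℂ) f, P f → P (c • f))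
    (h1 : ∀ x, P (Finsupp.single x 1)) (f) : P f := by
  refine Finsupp.induction_linear f h0 ha fun x c => ?_
  have := hs c _ (h1 x)
  rwa [Finsupp.smul_single, smul_eq_mul, mul_one] at this

/-- The bracket of eq. (6.29) is antisymmetric and satisfies the Jacobi identity, so the
free vector space on `{w[p,q,i,j,k]}` is a complex Lie algebra: the two-parameter
deformation of `L w_∧` associated to self-dual gravity on the Pedersen background. -/
theorem pedersen_lie_algebra (Λ ν : ℂ) :
    (∀ a b : (ℤ × ℤ × ℤ × ℤ × ℤ) →₀ ℂ,
      pedersenLieBracket Λ ν a b = -pedersenLieBracket Λ ν b a) ∧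
    (∀ a b c : (ℤ × ℤ × ℤ × ℤ × ℤ) →₀ ℂ,
      pedersenLieBracket Λ ν a (pedersenLieBracket Λ ν b c)
        + pedersenLieBracket Λ ν b (pedersenLieBracket Λ ν c a)
        + pedersenLieBracket Λ ν c (pedersenLieBracket Λ ν a b) = 0) := by
  simp only [pedB_eq]
  constructor
  · intro a b
    revert b
    refine ped_ext (P := fun a => ∀ b, pedB Λ ν a b = -pedB Λ ν b a) ?_ ?_ ?_ ?_ a
    · simp
    · intro f g hf hg b
      simp only [map_add, LinearMap.add_apply, hf b, hg b]; abel
    · intro c f hf b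
      simp only [map_smul, LinearMap.smul_apply, hf b, smul_neg]
    intro x b
    refine ped_ext (P := fun b => pedB Λ ν (Finsupp.single x 1) b = -pedB Λ ν b (Finsupp.single x 1)) ?_ ?_ ?_ ?_ b
    · simp
    · intro f g hf hg
      simp only [map_add, LinearMap.add_apply, hf, hg]; abel
    · intro c f hf
      simp only [map_smul, LinearMap.smul_apply, hf, smul_neg]
    intro y
    rw [pedB_single, pedB_single, ped_anti]
  · intro a b c
    revert b c
    refine ped_ext (P := fun a => ∀ b c, pedB Λ ν a (pedB Λ ν b c) + pedB Λ ν b (pedB Λ ν c a)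
      + pedB Λ ν c (pedB Λ ν a b) = 0) ?_ ?_ ?_ ?_ a
    · simp
    · intro f g hf hg b c
      have h := congrArg₂ (· + ·) (hf b c) (hg b c)
      simp only [map_add, LinearMap.add_apply, add_zero] at h ⊢
      rw [← h]; abel
    · intro d f hf b c
      have h := congrArg (d • ·) (hf b c)
      simpa only [map_smul, LinearMap.smul_apply, smul_add, smul_zero] using h
    intro x b c
    revert c
    refine ped_ext (P := fun b => ∀ c, pedB Λ ν (Finsupp.single x 1) (pedB Λ ν b c) + pedB Λ ν b (pedB Λ ν c (Finsupp.single x 1))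
      + pedB Λ ν c (pedB Λ ν (Finsupp.single x 1) b) = 0) ?_ ?_ ?_ ?_ b
    · simp
    · intro f g hf hg c
      have h := congrArg₂ (· + ·) (hf c) (hg c)
      simp only [map_add, LinearMap.add_apply, add_zero] at h ⊢
      rw [← h]; abel
    · intro d f hf c
      have h := congrArg (d • ·) (hf c)
      simpa only [map_smul, LinearMap.smul_apply, smul_add, smul_zero] using h
    intro y c
    refine ped_ext (P := fun c => pedB Λ ν (Finsupp.single x 1) (pedB Λ ν (Finsupp.single y 1) c) + pedB Λ ν (Finsupp.single y 1) (pedB Λ ν c (Finsupp.single x 1))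
      + pedB Λ ν c (pedB Λ ν (Finsupp.single x 1) (Finsupp.single y 1)) = 0) ?_ ?_ ?_ ?_ c
    · simp
    · intro f g hf hg
      have h := congrArg₂ (· + ·) hf hg
      simp only [map_add, LinearMap.add_apply, add_zero] at h ⊢
      rw [← h]; abel
    · intro d f hf
      have h := congrArg (d • ·) hf
      simpa only [map_smul, LinearMap.smul_apply, smul_add, smul_zero] using h
    intro z
    simp only [pedB_single]
    exact ped_jac Λ ν x y z
end
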